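/- Let A be a Young function such that A_{1/α−1/β}(t) = A(t^{1/α−1/β}) satisfies the ∇₂-condition (so that the Hardy–Littlewood maximal operator is bounded on the Orlicz space L^{A_{1/α−1/β}}). Under the hypotheses of the pointwise inequality (Ω ∈ L^ρ(𝕊^{n-1}) mean zero, 1 < ρ < n, α ≥ ρn/(ρn+ρ−n), 1 < α < β < n), if ∇f ∈ Ṁ^{α, αn/β}(ℝⁿ) and ∇f ∈ L^{A_{1−α/β}}(ℝⁿ), then ‖T_Ω f‖_{L^A} ≤ C ‖Ω‖_{L^ρ(𝕊^{n-1})} ‖∇f‖_{Ṁ^{α, αn/β}}^{α/β} ‖∇f‖_{L^{A_{1−α/β}}}^{1−α/β}. -/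

import Mathlib

open MeasureTheory Metric Set ENNReal Filter

noncomputable def morreyNorm (n : ℕ) (p q : ℝ) (f : EuclideanSpace ℝ (Fin n) → ℝ) : ℝ≥0∞ :=
  ⨆ (x : EuclideanSpace ℝ (Fin n)) (r : ℝ) (_ : 0 < r),
    (ENNReal.ofReal (r ^ (-((n : ℝ) * (1 - p / q)))) *
      ∫⁻ y in ball x r, ENNReal.ofReal (|f y| ^ p)) ^ (1 / p)

/-- Luxemburg norm of the Orlicz space `L^A(ℝⁿ)`. -/
noncomputable def luxemburgNorm (n : ℕ) (A : ℝ → ℝ) (f : EuclideanSpace ℝ (Fin n) → ℝ) : ℝ :=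
  sInf {lam : ℝ | 0 < lam ∧ (∫⁻ x, ENNReal.ofReal (A (|f x| / lam))) ≤ 1}

/-- `A` is a Young function. -/
def IsYoung (A : ℝ → ℝ) : Prop :=
  ∃ a : ℝ → ℝ, (∀ s t : ℝ, 0 ≤ s → s ≤ t → a s ≤ a t) ∧ a 0 = 0 ∧ (∀ s, 0 ≤ s → 0 ≤ a s) ∧
    (∀ t : ℝ, 0 < t → Tendsto a (nhdsWithin t (Iio t)) (nhds (a t))) ∧
    (∀ t : ℝ, 0 ≤ t → A t = ∫ s in (0 : ℝ)..t, a s)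

/-- The `∇₂`-condition for a Young function `B`. -/
def Nabla2 (B : ℝ → ℝ) : Prop :=
  ∃ C : ℝ, 1 < C ∧ ∀ r : ℝ, 0 ≤ r → B r ≤ B (C * r) / (2 * C)

section Maximal

set_option linter.unusedSectionVars false

variable {E : Type*} [NormedAddCommGroup E] [NormedSpace ℝ E] [FiniteDimensional ℝ E]
  [MeasurableSpace E] [BorelSpace E] (μ : Measure E) [μ.IsAddHaarMeasure]

/-- The uncentred Hardy–Littlewood maximal function. -/
noncomputable def maximalFn (h : E → ℝ≥0∞) (x : E) : ℝ≥0∞ :=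
  ⨆ (c : E) (r : ℝ) (_ : 0 < r),
    (ball c r).indicator (fun _ => (∫⁻ y in ball c r, h y ∂μ) / μ (ball c r)) x

theorem lintegral_ball_le_maximalFn (h : E → ℝ≥0∞) {c x : E} {r : ℝ} (hx : x ∈ ball c r) :
    ∫⁻ y in ball c r, h y ∂μ ≤ μ (ball c r) * maximalFn μ h x := by
  have hr : 0 < r := pos_of_mem_ball hx
  have h0 : μ (ball c r) ≠ 0 := (measure_ball_pos μ c hr).ne'
  have ht : μ (ball c r) ≠ ∞ := measure_ball_lt_top.ne
  have key : (∫⁻ y in ball c r, h y ∂μ) / μ (ball c r) ≤ maximalFn μ h x := by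
    have := le_iSup_of_le (f := fun c : E => ⨆ (r : ℝ) (_ : 0 < r),
      (ball c r).indicator (fun _ => (∫⁻ y in ball c r, h y ∂μ) / μ (ball c r)) x) c
      (le_iSup₂_of_le r hr le_rfl)
    rwa [indicator_of_mem hx] at this
  rw [mul_comm]
  exact (ENNReal.div_le_iff h0 ht).1 key

theorem measurable_maximalFn (h : E → ℝ≥0∞) : Measurable (maximalFn μ h) := by
  apply LowerSemicontinuous.measurable
  unfold maximalFn
  refine lowerSemicontinuous_iSup fun c => lowerSemicontinuous_iSup fun r =>
    lowerSemicontinuous_iSup fun _ => ?_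
  exact isOpen_ball.lowerSemicontinuous_indicator bot_le

theorem lt_maximalFn_iff {h : E → ℝ≥0∞} {x : E} {l : ℝ≥0∞} :
    l < maximalFn μ h x ↔ ∃ c r, x ∈ ball c r ∧ l * μ (ball c r) < ∫⁻ y in ball c r, h y ∂μ := by
  constructor
  · intro hl
    simp only [maximalFn, lt_iSup_iff] at hl
    obtain ⟨c, r, hr, hl⟩ := hl
    by_cases hx : x ∈ ball c r
    · rw [indicator_of_mem hx] at hl
      refine ⟨c, r, hx, ?_⟩
      exact (ENNReal.lt_div_iff_mul_lt (Or.inl (measure_ball_pos μ c hr).ne')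
        (Or.inl measure_ball_lt_top.ne)).1 hl
    · rw [indicator_of_notMem hx] at hl
      exact absurd hl (ENNReal.not_lt_zero)
  · rintro ⟨c, r, hx, hl⟩
    have := hl.trans_le (lintegral_ball_le_maximalFn μ h hx)
    rw [mul_comm] at this
    exact lt_of_mul_lt_mul_left' this

theorem maximalFn_le_add {h k : E → ℝ≥0∞} {a : ℝ≥0∞} (hk : ∀ y, h y ≤ k y + a) (x : E) :
    maximalFn μ h x ≤ maximalFn μ k x + a := by
  by_contra! hlt
  obtain ⟨c, r, hx, hl⟩ := (lt_maximalFn_iff μ).1 hlt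
  refine hl.not_ge ?_
  calc ∫⁻ y in ball c r, h y ∂μ ≤ ∫⁻ y in ball c r, (k y + a) ∂μ := lintegral_mono hk
    _ = (∫⁻ y in ball c r, k y ∂μ) + a * μ (ball c r) := by
        rw [lintegral_add_right _ measurable_const, setLIntegral_const]
    _ ≤ μ (ball c r) * maximalFn μ k x + a * μ (ball c r) := by
        gcongr; exact lintegral_ball_le_maximalFn μ k hx
    _ = _ := by ring

theorem maximalFn_const_mul {h : E → ℝ≥0∞} {a : ℝ≥0∞} (ha : a ≠ ∞) (x : E) :
    maximalFn μ (fun y => a * h y) x = a * maximalFn μ h x := by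
  simp only [maximalFn, ENNReal.mul_iSup]
  congr! 6 with c r hr
  by_cases hx : x ∈ ball c r
  · rw [indicator_of_mem hx, indicator_of_mem hx, lintegral_const_mul' _ _ ha, mul_div_assoc]
  · simp [indicator_of_notMem hx]

/-- The weak type `(1, 1)` inequality for the maximal function. -/
theorem mul_measure_lt_maximalFn_le [Nontrivial E] (h : E → ℝ≥0∞) (l : ℝ≥0∞) :
    l * μ {x | l < maximalFn μ h x} ≤ 4 ^ Module.finrank ℝ E * ∫⁻ y, h y ∂μ := by
  rcases eq_or_ne l 0 with rfl | hl0
  · simp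
  rcases eq_or_ne l ∞ with rfl | hlt
  · simp
  rcases eq_or_ne (∫⁻ y, h y ∂μ) ∞ with hI | hI
  · rw [hI, ENNReal.mul_top (by positivity)]; exact le_top
  set d := Module.finrank ℝ E with hd
  have hdpos : d ≠ 0 := Module.finrank_pos.ne'
  let t : Set (E × ℝ) := {p | 0 < p.2 ∧ l * μ (ball p.1 p.2) < ∫⁻ y in ball p.1 p.2, h y ∂μ}
  set Q : ℝ := ((∫⁻ y, h y ∂μ) / (l * μ (ball (0 : E) 1))).toReal with hQ
  have hb0 : μ (ball (0 : E) 1) ≠ 0 := (measure_ball_pos μ 0 one_pos).ne'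
  have hR : ∀ p ∈ t, p.2 ≤ max 1 Q := by
    rintro ⟨c, r⟩ ⟨hr, hp⟩
    simp only at hr hp ⊢
    rcases le_total r 1 with h1 | h1
    · exact le_max_of_le_left h1
    refine le_max_of_le_right ((le_self_pow₀ h1 hdpos).trans ?_)
    have h2 : ENNReal.ofReal (r ^ d) * (l * μ (ball (0 : E) 1)) ≤ ∫⁻ y, h y ∂μ := by
      calc ENNReal.ofReal (r ^ d) * (l * μ (ball (0 : E) 1)) = l * μ (ball c r) := by
            rw [μ.addHaar_ball_of_pos c hr]; ring
        _ ≤ _ := hp.le.trans (setLIntegral_le_lintegral _ _)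
    have h3 := ENNReal.le_div_iff_mul_le (a := ENNReal.ofReal (r ^ d)) (b := l * μ (ball (0 : E) 1))
      (c := ∫⁻ y, h y ∂μ) (Or.inl (mul_ne_zero hl0 hb0))
      (Or.inl (ENNReal.mul_ne_top hlt measure_ball_lt_top.ne)) |>.2 h2
    refine (ENNReal.ofReal_le_iff_le_toReal ?_).1 h3
    exact (ENNReal.div_lt_top hI (mul_ne_zero hl0 hb0)).ne
  obtain ⟨u, hut, hdisj, hcov⟩ := Vitali.exists_disjoint_subfamily_covering_enlargement_closedBall
    t Prod.fst Prod.snd _ hR 4 (by norm_num)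
  have hdisj' : u.PairwiseDisjoint fun p => ball p.1 p.2 :=
    hdisj.mono fun p => ball_subset_closedBall
  have hcount : u.Countable := by
    refine hdisj'.countable_of_isOpen (fun p _ => isOpen_ball) fun p hp => ?_
    exact nonempty_ball.2 (hut hp).1
  have hsub : {x | l < maximalFn μ h x} ⊆ ⋃ p ∈ u, closedBall p.1 (4 * p.2) := by
    intro x hx
    obtain ⟨c, r, hxc, hl⟩ := (lt_maximalFn_iff μ).1 hx
    obtain ⟨b, hbu, hb⟩ := hcov (c, r) ⟨pos_of_mem_ball hxc, hl⟩
    exact mem_biUnion hbu (hb (ball_subset_closedBall hxc))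
  calc l * μ {x | l < maximalFn μ h x} ≤ l * ∑' p : u, μ (closedBall p.1.1 (4 * p.1.2)) := by
        gcongr; exact (measure_mono hsub).trans (measure_biUnion_le μ hcount _)
    _ = ∑' p : u, 4 ^ d * (l * μ (ball p.1.1 p.1.2)) := by
        rw [← ENNReal.tsum_mul_left]
        congr 1 with p
        have hp : 0 < p.1.2 := (hut p.2).1
        rw [μ.addHaar_closedBall _ (by positivity), μ.addHaar_ball_of_pos _ hp, mul_pow,
          ENNReal.ofReal_mul (by positivity), ENNReal.ofReal_pow (by positivity)]
        norm_num
        ring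
    _ ≤ ∑' p : u, 4 ^ d * ∫⁻ y in ball p.1.1 p.1.2, h y ∂μ :=
        ENNReal.tsum_le_tsum fun p => by gcongr; exact (hut p.2).2.le
    _ = 4 ^ d * ∫⁻ y in ⋃ p ∈ u, ball p.1 p.2, h y ∂μ := by
        rw [ENNReal.tsum_mul_left, lintegral_biUnion hcount (fun p _ => measurableSet_ball) hdisj']
    _ ≤ _ := mul_le_mul_right (setLIntegral_le_lintegral _ _) _

/-- The maximal function is controlled in the modular of any `Φ` satisfying the `∇₂`-condition. -/
theorem exists_lintegral_maximalFn_le [Nontrivial E] {C : ℝ≥0∞} (hC : 1 < C) (hC' : C ≠ ∞) :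
    ∃ K : ℝ≥0∞, K ≠ 0 ∧ K ≠ ∞ ∧ ∀ Φ : ℝ≥0∞ → ℝ≥0∞, Monotone Φ → Φ 0 = 0 →
      (Φ ∞ ≤ ⨆ k : ℕ, Φ (C ^ k)) → (∀ r, 2 * C * Φ r ≤ Φ (C * r)) →
      ∀ h : E → ℝ≥0∞, Measurable h → (∀ x, h x ≠ ∞) →
        ∫⁻ x, Φ (maximalFn μ h x) ∂μ ≤ ∫⁻ x, Φ (K * h x) ∂μ := by
  have hC0 : C ≠ 0 := (zero_lt_one.trans hC).ne'
  set c : ℝ≥0∞ := 4 ^ Module.finrank ℝ E with hc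
  have hct : c ≠ ∞ := by simp [hc]
  obtain ⟨m, hm⟩ : ∃ m : ℕ, 2 * c * C ≤ 2 ^ m := by
    have hlt : 2 * c * C < ∞ := by finiteness
    have ht : Tendsto (fun m : ℕ => (2 : ℝ≥0∞) ^ m) atTop (nhds ∞) :=
      ENNReal.tendsto_pow_atTop_nhds_top_iff.2 (by norm_num)
    obtain ⟨m, hm⟩ := (ht.eventually (lt_mem_nhds hlt)).exists
    exact ⟨m, hm.le⟩
  refine ⟨C ^ m * (2 * C), by simp [hC0], by finiteness, fun Φ hmono h0 htop hdbl h hh hfin => ?_⟩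
  have hpow : ∀ r, 2 ^ m * Φ r ≤ Φ (C ^ m * r) := by
    intro r
    clear hm
    induction m with
    | zero => simp
    | succ m ih =>
      calc 2 ^ (m + 1) * Φ r = 2 * (2 ^ m * Φ r) := by ring
        _ ≤ (2 * C) * Φ (C ^ m * r) := by
            gcongr; exact le_mul_of_one_le_right' hC.le
        _ ≤ Φ (C * (C ^ m * r)) := hdbl _
        _ = _ := by ring_nf
  have hmeasM : ∀ k : ℤ, MeasurableSet {x | C ^ k < maximalFn μ h x} := fun k =>
    measurableSet_lt measurable_const (measurable_maximalFn μ h)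
  have hlevel : ∀ k : ℤ, MeasurableSet {x | C ^ k < 2 * h x} := fun k =>
    measurableSet_lt measurable_const (hh.const_mul _)
  have hzpos : ∀ k : ℤ, C ^ k ≠ 0 := fun k => (ENNReal.zpow_pos hC0 hC' k).ne'
  have hztop : ∀ k : ℤ, C ^ k ≠ ∞ := fun k => (ENNReal.zpow_lt_top hC0 hC' k).ne
  have hz1 : ∀ k : ℤ, C ^ (k + 1) = C * C ^ k := fun k => by
    rw [ENNReal.zpow_add hC0 hC', zpow_one, mul_comm]
  have hpt : ∀ t : ℝ≥0∞, Φ t ≤ ∑' k : ℤ, (Ioi (C ^ k)).indicator (fun _ => Φ (C ^ (k + 1))) t := by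
    intro t
    rcases eq_or_ne t 0 with rfl | ht0
    · simp [h0]
    rcases eq_or_ne t ∞ with rfl | htt
    · refine htop.trans (iSup_le fun k => ?_)
      refine le_trans ?_ (ENNReal.le_tsum ((k : ℤ) - 1))
      rw [indicator_of_mem (by simpa using (hztop _).lt_top)]
      simp
    · obtain ⟨k, hk⟩ := ENNReal.exists_mem_Ioc_zpow ht0 htt hC hC'
      refine le_trans ?_ (ENNReal.le_tsum k)
      rw [indicator_of_mem (show t ∈ Ioi (C ^ k) from hk.1)]
      exact hmono hk.2
  have hweak : ∀ k : ℤ, μ {x | C ^ k < maximalFn μ h x} ≤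
      (C ^ k)⁻¹ * (2 * c * ∫⁻ x in {x | C ^ k < 2 * h x}, h x ∂μ) := by
    intro k
    set l := C ^ k with hl
    have hle : ∀ y, h y ≤ {x | l < 2 * h x}.indicator h y + l / 2 := by
      intro y
      by_cases hy : y ∈ {x | l < 2 * h x}
      · rw [indicator_of_mem hy]; exact le_self_add
      · rw [indicator_of_notMem hy, zero_add]
        rw [ENNReal.le_div_iff_mul_le (by simp) (by simp), mul_comm]
        simpa using hy
    have hsub : {x | l < maximalFn μ h x} ⊆
        {x | l / 2 < maximalFn μ ({x | l < 2 * h x}.indicator h) x} := by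
      intro x hx
      by_contra hx'
      simp only [mem_ofPred_eq, not_lt] at hx hx'
      refine hx.not_ge ((maximalFn_le_add μ hle x).trans ?_)
      calc _ ≤ l / 2 + l / 2 := by gcongr
        _ = l := ENNReal.add_halves l
    have hw := mul_measure_lt_maximalFn_le μ ({x | l < 2 * h x}.indicator h) (l / 2)
    rw [lintegral_indicator (hlevel k)] at hw
    rw [mul_comm _⁻¹, ← div_eq_mul_inv, ENNReal.le_div_iff_mul_le (Or.inl (hzpos k)) (Or.inl (hztop k))]
    calc μ {x | l < maximalFn μ h x} * l
        ≤ μ {x | l / 2 < maximalFn μ ({x | l < 2 * h x}.indicator h) x} * l := by gcongr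
      _ = 2 * (l / 2 * μ {x | l / 2 < maximalFn μ ({x | l < 2 * h x}.indicator h) x}) := by
          rw [← mul_assoc, ENNReal.mul_div_cancel (by simp) (by simp), mul_comm]
      _ ≤ 2 * (c * ∫⁻ x in {x | l < 2 * h x}, h x ∂μ) := by gcongr
      _ = _ := by ring
  have hgeom : ∀ t : ℝ≥0∞, t ≠ ∞ →
      ∑' k : ℤ, (Ioi (C ^ k)).indicator (fun _ => Φ (C ^ (k + 1)) * (C ^ k)⁻¹ * t) (2 * t) ≤
        C * Φ (2 * C * t) := by
    intro t ht
    rcases eq_or_ne t 0 with rfl | ht0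
    · simp
    obtain ⟨m, hm⟩ := ENNReal.exists_mem_Ioc_zpow (x := 2 * t) (by simp [ht0]) (by finiteness)
      hC hC'
    have hinj : Function.Injective fun j : ℕ => m - (j : ℤ) := by
      intro a b hab; simpa using hab
    rw [← hinj.tsum_eq]
    swap
    · intro k hk
      have hk' : C ^ k < 2 * t := by
        by_contra hcon
        exact hk (indicator_of_notMem (by simpa using hcon) _)
      have : k < m + 1 := (ENNReal.monotone_zpow hC.le).reflect_lt (hk'.trans_le hm.2)
      exact ⟨(m - k).toNat, by simp; omega⟩
    have hb : ∀ j : ℕ, Φ (C ^ (m - (j : ℤ) + 1)) * (C ^ (m - (j : ℤ)))⁻¹ ≤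
        (2⁻¹) ^ j * (Φ (C ^ (m + 1)) * (C ^ m)⁻¹) := by
      intro j
      induction j with
      | zero => simp
      | succ j ih =>
        have e2 : m - ((j + 1 : ℕ) : ℤ) + 1 = m - (j : ℤ) := by push_cast; ring
        have e1 : C ^ (m - (j : ℤ)) = C * C ^ (m - ((j + 1 : ℕ) : ℤ)) := by rw [← hz1, e2]
        have e4 : (C ^ (m - ((j + 1 : ℕ) : ℤ)))⁻¹ = C * (C ^ (m - (j : ℤ)))⁻¹ := by
          rw [e1, ENNReal.mul_inv (Or.inl hC0) (Or.inl hC'), ← mul_assoc,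
            ENNReal.mul_inv_cancel hC0 hC', one_mul]
        rw [e2, e4]
        calc Φ (C ^ (m - (j : ℤ))) * (C * (C ^ (m - (j : ℤ)))⁻¹)
            = 2⁻¹ * 2 * (Φ (C ^ (m - (j : ℤ))) * (C * (C ^ (m - (j : ℤ)))⁻¹)) := by
              rw [ENNReal.inv_mul_cancel (by simp) (by simp), one_mul]
          _ = 2⁻¹ * (2 * C * Φ (C ^ (m - (j : ℤ))) * (C ^ (m - (j : ℤ)))⁻¹) := by ring
          _ ≤ 2⁻¹ * (Φ (C ^ (m - (j : ℤ) + 1)) * (C ^ (m - (j : ℤ)))⁻¹) := by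
              gcongr; rw [hz1]; exact hdbl _
          _ ≤ 2⁻¹ * (2⁻¹ ^ j * (Φ (C ^ (m + 1)) * (C ^ m)⁻¹)) := by gcongr
          _ = _ := by ring
    calc ∑' j : ℕ, (Ioi (C ^ (m - (j : ℤ)))).indicator
          (fun _ => Φ (C ^ (m - (j : ℤ) + 1)) * (C ^ (m - (j : ℤ)))⁻¹ * t) (2 * t)
        ≤ ∑' j : ℕ, (2⁻¹) ^ j * (Φ (C ^ (m + 1)) * (C ^ m)⁻¹ * t) := by
          refine ENNReal.tsum_le_tsum fun j => (indicator_le_self _ _ _).trans ?_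
          rw [← mul_assoc ((2⁻¹ : ℝ≥0∞) ^ j)]
          exact mul_le_mul_left (hb j) t
      _ = 2 * (Φ (C ^ (m + 1)) * (C ^ m)⁻¹ * t) := by
          rw [ENNReal.tsum_mul_right, ENNReal.tsum_geometric]
          simp
      _ = Φ (C ^ (m + 1)) * ((C ^ m)⁻¹ * (2 * t)) := by ring
      _ ≤ Φ (2 * C * t) * ((C ^ m)⁻¹ * (C ^ (m + 1))) := by
          gcongr
          · refine hmono ?_
            rw [hz1, mul_comm 2 C, mul_assoc]
            gcongr
            exact hm.1.le
          · exact hm.2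
      _ = C * Φ (2 * C * t) := by
          rw [hz1, mul_left_comm (C ^ m)⁻¹, ENNReal.inv_mul_cancel (hzpos m) (hztop m), mul_one,
            mul_comm]
  calc ∫⁻ x, Φ (maximalFn μ h x) ∂μ
      ≤ ∫⁻ x, ∑' k : ℤ, {x | C ^ k < maximalFn μ h x}.indicator (fun _ => Φ (C ^ (k + 1))) x ∂μ :=
        lintegral_mono fun x => hpt _
    _ = ∑' k : ℤ, Φ (C ^ (k + 1)) * μ {x | C ^ k < maximalFn μ h x} := by
        rw [lintegral_tsum fun k => (measurable_const.indicator (hmeasM k)).aemeasurable]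
        congr 1 with k
        rw [lintegral_indicator_const (hmeasM k)]
    _ ≤ ∑' k : ℤ, Φ (C ^ (k + 1)) *
          ((C ^ k)⁻¹ * (2 * c * ∫⁻ x in {x | C ^ k < 2 * h x}, h x ∂μ)) :=
        ENNReal.tsum_le_tsum fun k => by gcongr; exact hweak k
    _ = 2 * c * ∑' k : ℤ, ∫⁻ x, {x | C ^ k < 2 * h x}.indicator
          (fun x => Φ (C ^ (k + 1)) * (C ^ k)⁻¹ * h x) x ∂μ := by
        rw [← ENNReal.tsum_mul_left]
        congr 1 with k
        rw [lintegral_indicator (hlevel k), lintegral_const_mul _ hh]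
        ring
    _ = 2 * c * ∫⁻ x, ∑' k : ℤ, {x | C ^ k < 2 * h x}.indicator
          (fun x => Φ (C ^ (k + 1)) * (C ^ k)⁻¹ * h x) x ∂μ := by
        rw [lintegral_tsum fun k => ((hh.const_mul _).indicator (hlevel k)).aemeasurable]
    _ ≤ 2 * c * ∫⁻ x, C * Φ (2 * C * h x) ∂μ := by
        gcongr with x
        exact hgeom _ (hfin x)
    _ = ∫⁻ x, 2 * c * C * Φ (2 * C * h x) ∂μ := by
        rw [← lintegral_const_mul' _ _ (by finiteness)]
        simp only [mul_assoc]
    _ ≤ ∫⁻ x, Φ (C ^ m * (2 * C) * h x) ∂μ := by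
        refine lintegral_mono fun x => ?_
        rw [mul_assoc (C ^ m)]
        exact (mul_le_mul_left hm _).trans (hpow _)

end Maximal

theorem exists_lintegral_maximalFn_rpow_le {E : Type*} [NormedAddCommGroup E] [NormedSpace ℝ E]
    [FiniteDimensional ℝ E] [MeasurableSpace E] [BorelSpace E] (μ : Measure E)
    [μ.IsAddHaarMeasure] [Nontrivial E] {ρ : ℝ} (hρ : 1 < ρ) :
    ∃ K : ℝ≥0∞, K ≠ ∞ ∧ ∀ h : E → ℝ≥0∞, Measurable h → (∀ x, h x ≠ ∞) →
      ∫⁻ x, maximalFn μ h x ^ ρ ∂μ ≤ K * ∫⁻ x, h x ^ ρ ∂μ := by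
  have hρ1 : 0 < ρ - 1 := by linarith
  have hρ0 : 0 < ρ := by linarith
  set C : ℝ≥0∞ := 2 ^ (1 / (ρ - 1)) with hCdef
  have hC : 1 < C := ENNReal.one_lt_rpow (by norm_num) (by positivity)
  have hC' : C ≠ ∞ := ENNReal.rpow_ne_top_of_nonneg (by positivity) (by norm_num)
  have hCρ : C ^ ρ = 2 * C := by
    rw [hCdef, ← ENNReal.rpow_mul]
    nth_rewrite 2 [← ENNReal.rpow_one 2]
    rw [← ENNReal.rpow_add _ _ (by norm_num) (by norm_num)]
    congr 1
    field_simp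
    ring
  obtain ⟨K, hK0, hKt, hK⟩ := exists_lintegral_maximalFn_le μ hC hC'
  refine ⟨K ^ ρ, by finiteness, fun h hh hfin => ?_⟩
  have := hK (· ^ ρ) (ENNReal.monotone_rpow_of_nonneg hρ0.le) (by simp [hρ0]) ?_ ?_ h hh hfin
  · refine this.trans (le_of_eq ?_)
    rw [← lintegral_const_mul' _ _ (by finiteness)]
    simp only [ENNReal.mul_rpow_of_nonneg _ _ hρ0.le]
  · have ht : Tendsto (fun m : ℕ => C ^ m) atTop (nhds ∞) :=
      ENNReal.tendsto_pow_atTop_nhds_top_iff.2 hC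
    refine le_top.trans_eq (Eq.symm (iSup_eq_top.2 fun b hb => ?_))
    obtain ⟨m, hm⟩ := (ht.eventually (lt_mem_nhds hb)).exists
    refine ⟨m, hm.trans_le ?_⟩
    exact ENNReal.le_rpow_self_of_one_le (one_le_pow₀ hC.le) hρ.le
  · intro r
    rw [ENNReal.mul_rpow_of_nonneg _ _ hρ0.le, hCρ]

section Prelim

set_option linter.unusedSectionVars false

variable {E : Type*} [NormedAddCommGroup E] [NormedSpace ℝ E] [FiniteDimensional ℝ E]
  [MeasurableSpace E] [BorelSpace E] (μ : Measure E) [μ.IsAddHaarMeasure]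

theorem lintegral_comp_add_smul {g : E → ℝ≥0∞} (hg : Measurable g) (a : E) {R : ℝ} (hR : R ≠ 0) :
    ∫⁻ u, g (a + R • u) ∂μ =
      ENNReal.ofReal |(R ^ Module.finrank ℝ E)⁻¹| * ∫⁻ z, g z ∂μ := by
  calc ∫⁻ u, g (a + R • u) ∂μ = ∫⁻ z, g (a + z) ∂(Measure.map (R • ·) μ) := by
        rw [lintegral_map (by fun_prop) (by fun_prop)]
    _ = _ := by
        rw [Measure.map_addHaar_smul μ hR, lintegral_smul_measure, lintegral_add_left_eq_self,
          smul_eq_mul]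

theorem setLIntegral_ball_comp_lineMap {g : E → ℝ≥0∞} (hg : Measurable g) (y : E) {t : ℝ}
    (ht : 0 < t) (r : ℝ) :
    ∫⁻ w in ball y r, g (y + t • (w - y)) ∂μ =
      ENNReal.ofReal (t ^ (-(Module.finrank ℝ E : ℝ))) * ∫⁻ z in ball y (t * r), g z ∂μ := by
  have h := lintegral_comp_add_smul μ (hg.indicator (measurableSet_ball (x := y) (ε := t * r)))
    (y - t • y) ht.ne'
  rw [lintegral_indicator measurableSet_ball] at h
  rw [← lintegral_indicator measurableSet_ball, Real.rpow_neg ht.le, Real.rpow_natCast]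
  rw [abs_of_pos (by positivity)] at h
  rw [← h]
  refine lintegral_congr fun w => ?_
  have e : y - t • y + t • w = y + t • (w - y) := by rw [smul_sub]; abel
  rw [e]
  have : w ∈ ball y r ↔ y + t • (w - y) ∈ ball y (t * r) := by
    rw [mem_ball_iff_norm, mem_ball_iff_norm, add_sub_cancel_left, norm_smul, Real.norm_of_nonneg ht.le,
      mul_lt_mul_iff_right₀ ht]
  by_cases hw : w ∈ ball y r
  · rw [indicator_of_mem hw, indicator_of_mem (this.1 hw)]
  · rw [indicator_of_notMem hw, indicator_of_notMem (this.not.1 hw)]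

theorem enorm_sub_le_lintegral_enorm_fderiv {F : E → ℝ} (hF : Differentiable ℝ F) (y w : E) :
    ‖F y - F w‖ₑ ≤ ∫⁻ t in Ioc (0 : ℝ) 1, ‖fderiv ℝ F (y + t • (w - y))‖ₑ * ‖w - y‖ₑ := by
  by_cases htop : ∫⁻ t in Ioc (0 : ℝ) 1, ‖fderiv ℝ F (y + t • (w - y))‖ₑ * ‖w - y‖ₑ = ∞
  · rw [htop]; exact le_top
  have hd : ∀ t : ℝ, HasDerivAt (fun t : ℝ => F (y + t • (w - y)))
      (fderiv ℝ F (y + t • (w - y)) (w - y)) t := by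
    intro t
    have h1 : HasDerivAt (fun t : ℝ => y + t • (w - y)) (w - y) t := by
      simpa using ((hasDerivAt_id t).smul_const (w - y)).const_add y
    exact (hF _).hasFDerivAt.comp_hasDerivAt t h1
  have hmeas : Measurable fun t : ℝ => fderiv ℝ F (y + t • (w - y)) (w - y) :=
    (measurable_fderiv_apply_const ℝ F (w - y)).comp (by fun_prop)
  have hle : ∫⁻ t in Ioc (0 : ℝ) 1, ‖fderiv ℝ F (y + t • (w - y)) (w - y)‖ₑ ≤
      ∫⁻ t in Ioc (0 : ℝ) 1, ‖fderiv ℝ F (y + t • (w - y))‖ₑ * ‖w - y‖ₑ :=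
    lintegral_mono fun t => ContinuousLinearMap.le_opENorm _ _
  have h_int : IntervalIntegrable (fun t : ℝ => fderiv ℝ F (y + t • (w - y)) (w - y)) volume 0 1 := by
    rw [intervalIntegrable_iff_integrableOn_Ioc_of_le zero_le_one]
    exact ⟨hmeas.aestronglyMeasurable, hle.trans_lt (lt_top_iff_ne_top.2 htop)⟩
  have := intervalIntegral.integral_eq_sub_of_hasDerivAt (fun t _ => hd t) h_int
  rw [intervalIntegral.integral_of_le zero_le_one] at this
  simp only [one_smul, add_sub_cancel, zero_smul, add_zero] at this
  rw [← neg_sub, enorm_neg, ← this]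
  exact (enorm_integral_le_lintegral_enorm _).trans hle

theorem lintegral_ball_enorm_sub_le {F : E → ℝ} (hF : Differentiable ℝ F) (y : E) {r : ℝ} :
    ∫⁻ w in ball y r, ‖F y - F w‖ₑ ∂μ ≤
      ENNReal.ofReal r * ∫⁻ t in Ioc (0 : ℝ) 1,
        ENNReal.ofReal (t ^ (-(Module.finrank ℝ E : ℝ))) *
          ∫⁻ z in ball y (t * r), ‖fderiv ℝ F z‖ₑ ∂μ := by
  have hm : Measurable fun z => ‖fderiv ℝ F z‖ₑ := (measurable_fderiv ℝ F).enorm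
  calc ∫⁻ w in ball y r, ‖F y - F w‖ₑ ∂μ
      ≤ ∫⁻ w in ball y r, (∫⁻ t in Ioc (0 : ℝ) 1,
          ‖fderiv ℝ F (y + t • (w - y))‖ₑ * ENNReal.ofReal r) ∂μ := by
        refine setLIntegral_mono' measurableSet_ball fun w hw => ?_
        refine (enorm_sub_le_lintegral_enorm_fderiv hF y w).trans ?_
        gcongr
        rw [← ofReal_norm]
        exact ENNReal.ofReal_le_ofReal (mem_ball_iff_norm.1 hw).le
    _ = ∫⁻ t in Ioc (0 : ℝ) 1, (∫⁻ w in ball y r,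
          ‖fderiv ℝ F (y + t • (w - y))‖ₑ * ENNReal.ofReal r ∂μ) := by
        refine lintegral_lintegral_swap (Measurable.aemeasurable ?_)
        refine Measurable.mul_const (hm.comp ?_) _
        fun_prop
    _ = ENNReal.ofReal r * ∫⁻ t in Ioc (0 : ℝ) 1, (∫⁻ w in ball y r,
          ‖fderiv ℝ F (y + t • (w - y))‖ₑ ∂μ) := by
        rw [← lintegral_const_mul' _ _ ENNReal.ofReal_ne_top]
        congr 1 with t
        rw [lintegral_mul_const' _ _ ENNReal.ofReal_ne_top, mul_comm]
    _ = _ := by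
        congr 1
        refine setLIntegral_congr_fun measurableSet_Ioc fun t ht => ?_
        exact setLIntegral_ball_comp_lineMap μ hm y ht.1 r

theorem exists_lintegral_min_rpow_le {γ : ℝ} (hγ : 0 < γ) :
    ∃ c : ℝ≥0∞, c ≠ ∞ ∧ ∀ a b : ℝ≥0∞,
      ∫⁻ r in Ioi (0 : ℝ), min a (b * ENNReal.ofReal (r ^ (-(1 + γ)))) ≤
        c * (a ^ (γ / (1 + γ)) * b ^ (1 / (1 + γ))) := by
  have hg1 : 0 < 1 + γ := by linarith
  refine ⟨ENNReal.ofReal (1 + 1 / γ), by finiteness, fun a b => ?_⟩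
  have hc : ENNReal.ofReal (1 + 1 / γ) ≠ 0 := by
    simp only [ne_eq, ENNReal.ofReal_eq_zero, not_le]; positivity
  rcases eq_or_ne a 0 with rfl | ha0
  · simp
  rcases eq_or_ne b 0 with rfl | hb0
  · simp
  have hap : a ^ (γ / (1 + γ)) ≠ 0 := by simp [ha0]; intro _; positivity
  have hbp : b ^ (1 / (1 + γ)) ≠ 0 := by simp [hb0]; intro _; positivity
  rcases eq_or_ne a ∞ with rfl | hat
  · rw [ENNReal.top_rpow_of_pos (by positivity), ENNReal.top_mul hbp, ENNReal.mul_top hc]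
    exact le_top
  rcases eq_or_ne b ∞ with rfl | hbt
  · rw [ENNReal.top_rpow_of_pos (y := 1 / (1 + γ)) (by positivity), ENNReal.mul_top hap,
      ENNReal.mul_top hc]
    exact le_top
  lift a to NNReal using hat
  lift b to NNReal using hbt
  have ha : (0 : ℝ) < a := by
    have : a ≠ 0 := by simpa using ha0
    positivity
  have hb : (0 : ℝ) < b := by
    have : b ≠ 0 := by simpa using hb0
    positivity
  set s : ℝ := ((b : ℝ) / a) ^ (1 / (1 + γ)) with hs
  have hspos : 0 < s := by positivity
  have hI : ∫⁻ r in Ioi s, ENNReal.ofReal (r ^ (-(1 + γ))) = ENNReal.ofReal (s ^ (-γ) / γ) := by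
    rw [← ofReal_integral_eq_lintegral_ofReal]
    · rw [integral_Ioi_rpow_of_lt (by linarith) hspos]
      congr 1
      have : -(1 + γ) + 1 = -γ := by ring
      rw [this, neg_div_neg_eq]
    · exact integrableOn_Ioi_rpow_of_lt (by linarith) hspos
    · exact (ae_restrict_mem measurableSet_Ioi).mono fun r hr =>
        Real.rpow_nonneg (hspos.trans hr).le _
  have key : (a : ℝ) * s + b * (s ^ (-γ) / γ) =
      (1 + 1 / γ) * ((a : ℝ) ^ (γ / (1 + γ)) * (b : ℝ) ^ (1 / (1 + γ))) := by
    have e1 : (a : ℝ) * s = (a : ℝ) ^ (γ / (1 + γ)) * (b : ℝ) ^ (1 / (1 + γ)) := by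
      rw [hs, Real.div_rpow hb.le ha.le]
      have : (a : ℝ) = (a : ℝ) ^ (γ / (1 + γ)) * (a : ℝ) ^ (1 / (1 + γ)) := by
        rw [← Real.rpow_add ha, ← add_div, add_comm γ 1, div_self hg1.ne', Real.rpow_one]
      nth_rewrite 1 [this]
      field_simp
    have e2 : (b : ℝ) * s ^ (-γ) = (a : ℝ) ^ (γ / (1 + γ)) * (b : ℝ) ^ (1 / (1 + γ)) := by
      rw [hs, ← Real.rpow_mul (by positivity), Real.div_rpow hb.le ha.le]
      have : (b : ℝ) = (b : ℝ) ^ (1 / (1 + γ)) * (b : ℝ) ^ (γ / (1 + γ)) := by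
        rw [← Real.rpow_add hb, ← add_div, div_self hg1.ne', Real.rpow_one]
      have e3 : 1 / (1 + γ) * -γ = -(γ / (1 + γ)) := by ring
      rw [e3, Real.rpow_neg ha.le, Real.rpow_neg hb.le]
      nth_rewrite 1 [this]
      field_simp
    rw [mul_div_assoc', e2, e1]; ring
  calc ∫⁻ r in Ioi (0 : ℝ), min (a : ℝ≥0∞) (b * ENNReal.ofReal (r ^ (-(1 + γ))))
      ≤ (∫⁻ r in Ioc (0 : ℝ) s, min (a : ℝ≥0∞) (b * ENNReal.ofReal (r ^ (-(1 + γ))))) +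
          ∫⁻ r in Ioi s, min (a : ℝ≥0∞) (b * ENNReal.ofReal (r ^ (-(1 + γ)))) := by
        rw [← Ioc_union_Ioi_eq_Ioi hspos.le]
        exact lintegral_union_le _ _ _
    _ ≤ (∫⁻ r in Ioc (0 : ℝ) s, (a : ℝ≥0∞)) +
          ∫⁻ r in Ioi s, b * ENNReal.ofReal (r ^ (-(1 + γ))) := by
        gcongr
        · exact min_le_left _ _
        · exact min_le_right _ _
    _ = ENNReal.ofReal ((a : ℝ) * s + b * (s ^ (-γ) / γ)) := by
        rw [lintegral_const_mul' _ _ (by finiteness), hI, setLIntegral_const, Real.volume_Ioc, sub_zero,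
          ENNReal.ofReal_add (by positivity) (by positivity), ENNReal.ofReal_mul ha.le,
          ENNReal.ofReal_mul hb.le, ENNReal.ofReal_coe_nnreal, ENNReal.ofReal_coe_nnreal]
    _ = _ := by
        rw [key, ENNReal.ofReal_mul (by positivity), ENNReal.ofReal_mul (by positivity),
          ← ENNReal.ofReal_rpow_of_pos ha, ← ENNReal.ofReal_rpow_of_pos hb,
          ENNReal.ofReal_coe_nnreal, ENNReal.ofReal_coe_nnreal]

end Prelim

section Polar

set_option linter.unusedSectionVars false

variable {E : Type*} [NormedAddCommGroup E] [NormedSpace ℝ E] [FiniteDimensional ℝ E]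
  [MeasurableSpace E] [BorelSpace E] [Nontrivial E] (μ : Measure E) [μ.IsAddHaarMeasure]

/-- The annulus `{1 < ‖y‖ ≤ 2}`. -/
def unitAnnulus (E : Type*) [NormedAddCommGroup E] : Set E := {y | 1 < ‖y‖ ∧ ‖y‖ ≤ 2}

theorem measurableSet_unitAnnulus : MeasurableSet (unitAnnulus E) :=
  (measurableSet_lt measurable_const measurable_norm).inter
    (measurableSet_le measurable_norm measurable_const)

theorem volumeIoiPow_Ioc_lt_top (m : ℕ) :
    Measure.volumeIoiPow m {r : Ioi (0 : ℝ) | 1 < (r : ℝ) ∧ (r : ℝ) ≤ 2} < ∞ := by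
  refine (measure_mono (t := Iio ⟨3, by norm_num [mem_Ioi]⟩) fun r hr => ?_).trans_lt ?_
  · exact Subtype.coe_lt_coe.1 (hr.2.trans_lt (by norm_num : (2 : ℝ) < 3))
  · rw [Measure.volumeIoiPow_apply_Iio]; exact ENNReal.ofReal_lt_top

theorem measurableSet_subtype_Ioc :
    MeasurableSet {r : Ioi (0 : ℝ) | 1 < (r : ℝ) ∧ (r : ℝ) ≤ 2} :=
  (measurableSet_lt measurable_const measurable_subtype_coe).inter
    (measurableSet_le measurable_subtype_coe measurable_const)

variable {Ω : E → ℝ}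

theorem apply_homeomorphUnitSphereProd_fst (hΩ : ∀ c : ℝ, 0 < c → ∀ y, Ω (c • y) = Ω y)
    (x : ({0}ᶜ : Set E)) : Ω (homeomorphUnitSphereProd E x).1 = Ω x := by
  have hx : (x : E) ≠ 0 := x.2
  rw [homeomorphUnitSphereProd_apply_fst_coe]
  exact hΩ _ (by positivity) _

theorem exists_lintegral_unitAnnulus_le (ρ : ℝ) :
    ∃ c : ℝ≥0∞, c ≠ ∞ ∧ ∀ Ω : E → ℝ, Measurable Ω → (∀ c : ℝ, 0 < c → ∀ y, Ω (c • y) = Ω y) →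
      ∫⁻ y in unitAnnulus E, ‖Ω y‖ₑ ^ ρ ∂μ =
        c * ∫⁻ z : sphere (0 : E) 1, ‖Ω z‖ₑ ^ ρ ∂μ.toSphere := by
  refine ⟨_, (volumeIoiPow_Ioc_lt_top (Module.finrank ℝ E - 1)).ne, fun Ω hm hΩ => ?_⟩
  set s := {r : Ioi (0 : ℝ) | 1 < (r : ℝ) ∧ (r : ℝ) ≤ 2}
  rw [← lintegral_indicator measurableSet_unitAnnulus]
  nth_rewrite 1 [← restrict_compl_singleton (μ := μ) 0]
  rw [← lintegral_subtype_comap (measurableSet_singleton _).compl]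
  have h1 := μ.measurePreserving_homeomorphUnitSphereProd.lintegral_comp_emb
    (Homeomorph.measurableEmbedding _)
    (fun p : sphere (0 : E) 1 × Ioi (0 : ℝ) => ‖Ω p.1‖ₑ ^ ρ * s.indicator 1 p.2)
  rw [lintegral_prod_mul (f := fun z : sphere (0 : E) 1 => ‖Ω z‖ₑ ^ ρ) (g := s.indicator 1)
    (((hm.comp measurable_subtype_coe).enorm).pow_const _).aemeasurable
    (measurable_one.indicator measurableSet_subtype_Ioc).aemeasurable,
    lintegral_indicator_one measurableSet_subtype_Ioc] at h1
  rw [mul_comm, ← h1]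
  refine lintegral_congr fun x => ?_
  rw [apply_homeomorphUnitSphereProd_fst hΩ]
  by_cases hx : (x : E) ∈ unitAnnulus E
  · rw [indicator_of_mem hx, indicator_of_mem, Pi.one_apply, mul_one]
    simpa [s, unitAnnulus] using hx
  · rw [indicator_of_notMem hx, indicator_of_notMem, mul_zero]
    simpa [s, unitAnnulus] using hx

theorem integrableOn_unitAnnulus_and_integral_eq_zero (m : ℕ)
    (hΩ : ∀ c : ℝ, 0 < c → ∀ y, Ω (c • y) = Ω y)
    (h_int : Integrable (fun z : sphere (0 : E) 1 => Ω z) μ.toSphere)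
    (hzero : ∫ z : sphere (0 : E) 1, Ω z ∂μ.toSphere = 0) :
    IntegrableOn (fun y => Ω y / ‖y‖ ^ m) (unitAnnulus E) μ ∧
      ∫ y in unitAnnulus E, Ω y / ‖y‖ ^ m ∂μ = 0 := by
  set s := {r : Ioi (0 : ℝ) | 1 < (r : ℝ) ∧ (r : ℝ) ≤ 2} with hs
  set v : Ioi (0 : ℝ) → ℝ := s.indicator fun r => ((r : ℝ) ^ m)⁻¹ with hv
  have hvint : Integrable v (Measure.volumeIoiPow (Module.finrank ℝ E - 1)) := by
    rw [hv, integrable_indicator_iff measurableSet_subtype_Ioc]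
    refine IntegrableOn.of_bound (volumeIoiPow_Ioc_lt_top _) ?_ 1 ?_
    · exact (measurable_subtype_coe.pow_const m).inv.aestronglyMeasurable
    · filter_upwards [ae_restrict_mem measurableSet_subtype_Ioc] with r hr
      rw [Real.norm_of_nonneg (inv_nonneg.2 (pow_nonneg (zero_le_one.trans hr.1.le) _))]
      exact inv_le_one_of_one_le₀ (one_le_pow₀ hr.1.le)
  have heq : ∀ x : ({0}ᶜ : Set E),
      Ω (homeomorphUnitSphereProd E x).1 * v (homeomorphUnitSphereProd E x).2 =
        (unitAnnulus E).indicator (fun y => Ω y / ‖y‖ ^ m) x := by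
    intro x
    rw [apply_homeomorphUnitSphereProd_fst hΩ]
    by_cases hx : (x : E) ∈ unitAnnulus E
    · rw [indicator_of_mem hx, hv, indicator_of_mem]
      · simp [div_eq_mul_inv]
      · simpa [s, unitAnnulus] using hx
    · rw [indicator_of_notMem hx, hv, indicator_of_notMem, mul_zero]
      simpa [s, unitAnnulus] using hx
  have hMP := μ.measurePreserving_homeomorphUnitSphereProd
  have hme := (Homeomorph.measurableEmbedding (homeomorphUnitSphereProd E))
  constructor
  · have h1 := (hMP.integrable_comp_emb hme).2 (h_int.mul_prod hvint)
    rw [← integrable_indicator_iff measurableSet_unitAnnulus,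
      ← restrict_compl_singleton (μ := μ) 0, ← IntegrableOn,
      integrableOn_iff_comap_subtypeVal (measurableSet_singleton _).compl]
    exact h1.congr (Eventually.of_forall heq)
  · have h1 := hMP.integral_comp hme (fun p => Ω p.1 * v p.2)
    rw [integral_prod_mul (fun z : sphere (0 : E) 1 => Ω z) v, hzero, zero_mul] at h1
    rw [← integral_indicator measurableSet_unitAnnulus, ← restrict_compl_singleton (μ := μ) 0,
      ← integral_subtype_comap (measurableSet_singleton _).compl, ← h1]
    exact integral_congr_ae (Eventually.of_forall fun x => (heq x).symm)

end Polar

section Riesz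

set_option linter.unusedSectionVars false

variable {E : Type*} [NormedAddCommGroup E] [NormedSpace ℝ E] [FiniteDimensional ℝ E]
  [MeasurableSpace E] [BorelSpace E] (μ : Measure E) [μ.IsAddHaarMeasure]

/-- The truncated Riesz potential of order one, written as an integral of averages over balls. -/
noncomputable def rieszBall (h : E → ℝ≥0∞) (z : E) : ℝ≥0∞ :=
  ∫⁻ t in Ioc (0 : ℝ) 1, ENNReal.ofReal (t ^ (-(Module.finrank ℝ E : ℝ))) *
    ∫⁻ y in ball z (t * 3), h y ∂μ

/-- The kernel of `rieszBall`. -/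
noncomputable def rieszKernel (E : Type*) [NormedAddCommGroup E] [NormedSpace ℝ E]
    (t : ℝ) (y z : E) : ℝ≥0∞ :=
  ENNReal.ofReal (t ^ (-(Module.finrank ℝ E : ℝ))) *
    {p : ℝ × E × E | dist p.2.1 p.2.2 < p.1 * 3}.indicator 1 (t, y, z)

theorem measurable_rieszKernel :
    Measurable fun p : ℝ × E × E => rieszKernel E p.1 p.2.1 p.2.2 := by
  unfold rieszKernel
  refine Measurable.mul (by fun_prop) (measurable_one.indicator ?_)
  exact measurableSet_lt (by fun_prop) (by fun_prop)

theorem rieszBall_eq (h : E → ℝ≥0∞) (z : E) :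
    rieszBall μ h z = ∫⁻ t in Ioc (0 : ℝ) 1, ∫⁻ y, rieszKernel E t y z * h y ∂μ := by
  unfold rieszBall
  refine lintegral_congr fun t => ?_
  rw [← lintegral_indicator measurableSet_ball, ← lintegral_const_mul' _ _ ENNReal.ofReal_ne_top]
  refine lintegral_congr fun y => ?_
  unfold rieszKernel
  by_cases hy : y ∈ ball z (t * 3)
  · rw [indicator_of_mem hy, indicator_of_mem (by simpa using hy)]; simp
  · rw [indicator_of_notMem hy, indicator_of_notMem (by simpa using hy)]; simp

theorem measurable_rieszBall {h : E → ℝ≥0∞} (hh : Measurable h) : Measurable (rieszBall μ h) := by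
  rw [funext (rieszBall_eq μ h)]
  refine Measurable.lintegral_prod_right' (f := fun p : E × ℝ =>
    ∫⁻ y, rieszKernel E p.2 y p.1 * h y ∂μ) ?_
  refine Measurable.lintegral_prod_right' (f := fun p : (E × ℝ) × E =>
    rieszKernel E p.1.2 p.2 p.1.1 * h p.2) ?_
  refine Measurable.mul ?_ (by fun_prop)
  exact measurable_rieszKernel.comp
    (f := fun p : (E × ℝ) × E => (p.1.2, p.2, p.1.1)) (by fun_prop)

theorem lintegral_mul_rieszBall_comm {h k : E → ℝ≥0∞} (hh : Measurable h) (hk : Measurable k) :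
    ∫⁻ y, h y * rieszBall μ k y ∂μ = ∫⁻ z, k z * rieszBall μ h z ∂μ := by
  have hkey : ∀ {h k : E → ℝ≥0∞} (_ : Measurable h) (_ : Measurable k),
      ∫⁻ y, h y * rieszBall μ k y ∂μ =
        ∫⁻ t in Ioc (0 : ℝ) 1, ∫⁻ y, ∫⁻ z, h y * (rieszKernel E t z y * k z) ∂μ ∂μ := by
    intro h k hh hk
    have hker : Measurable fun p : (E × ℝ) × E => rieszKernel E p.1.2 p.2 p.1.1 :=
      measurable_rieszKernel.comp (f := fun p : (E × ℝ) × E => (p.1.2, p.2, p.1.1)) (by fun_prop)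
    have hm1 : Measurable fun p : E × ℝ => ∫⁻ z, rieszKernel E p.2 z p.1 * k z ∂μ :=
      Measurable.lintegral_prod_right' (f := fun p : (E × ℝ) × E =>
        rieszKernel E p.1.2 p.2 p.1.1 * k p.2) (hker.mul (by fun_prop))
    have hm2 : Measurable fun p : (E × ℝ) × E => rieszKernel E p.1.2 p.2 p.1.1 * k p.2 :=
      hker.mul (by fun_prop)
    calc ∫⁻ y, h y * rieszBall μ k y ∂μ
        = ∫⁻ y, (∫⁻ t in Ioc (0 : ℝ) 1, h y * ∫⁻ z, rieszKernel E t z y * k z ∂μ) ∂μ := by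
          refine lintegral_congr fun y => ?_
          rw [rieszBall_eq μ k, lintegral_const_mul]
          exact hm1.comp (f := fun t : ℝ => (y, t)) (by fun_prop)
      _ = ∫⁻ t in Ioc (0 : ℝ) 1, ∫⁻ y, h y * ∫⁻ z, rieszKernel E t z y * k z ∂μ ∂μ :=
          lintegral_lintegral_swap ((hh.comp measurable_fst).mul hm1).aemeasurable
      _ = _ := by
          refine lintegral_congr fun t => lintegral_congr fun y => ?_
          rw [lintegral_const_mul]
          exact hm2.comp (f := fun z : E => ((y, t), z)) (by fun_prop)
  rw [hkey hh hk, hkey hk hh]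
  refine lintegral_congr fun t => ?_
  rw [lintegral_lintegral_swap]
  · refine lintegral_congr fun y => lintegral_congr fun z => ?_
    have : rieszKernel E t z y = rieszKernel E t y z := by
      unfold rieszKernel
      congr 1
      simp only [indicator, mem_ofPred_eq, dist_comm z y, Pi.one_apply]
    rw [this]
    ring
  · refine ((hh.comp measurable_fst).mul (Measurable.mul ?_ (hk.comp measurable_snd))).aemeasurable
    exact measurable_rieszKernel.comp (f := fun p : E × E => (t, p.2, p.1)) (by fun_prop)

/-- The Hardy–Littlewood–Sobolev inequality, by Hedberg's argument. -/
theorem exists_lintegral_rieszBall_rpow_le [Nontrivial E] {ρ : ℝ} (hρ : 1 < ρ)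
    (hρd : ρ < Module.finrank ℝ E) :
    ∃ c : ℝ≥0∞, c ≠ ∞ ∧ ∀ u : E → ℝ, Measurable u →
      (∫⁻ z, rieszBall μ (fun y => ‖u y‖ₑ) z ^
          (Module.finrank ℝ E * ρ / (Module.finrank ℝ E - ρ)) ∂μ) ^
          (1 / (Module.finrank ℝ E * ρ / (Module.finrank ℝ E - ρ))) ≤
        c * (∫⁻ y, ‖u y‖ₑ ^ ρ ∂μ) ^ (1 / ρ) := by
  set d : ℝ := (Module.finrank ℝ E : ℝ) with hd
  have hd0 : 0 < d := by linarith
  have hρ0 : 0 < ρ := by linarith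
  set γ : ℝ := d / ρ - 1 with hγ
  have hγ0 : 0 < γ := by rw [hγ, sub_pos, one_lt_div hρ0]; exact hρd
  have hdρ : 0 < d - ρ := by linarith
  set q : ℝ := d * ρ / (d - ρ) with hq
  have hq0 : 0 < q := by positivity
  have h1γ : 1 + γ = d / ρ := by rw [hγ]; ring
  set θ : ℝ := γ / (1 + γ) with hθ
  set η : ℝ := 1 / (1 + γ) with hη
  have hθ0 : 0 < θ := by positivity
  have hη0 : 0 < η := by positivity
  have hθq : θ * q = ρ := by
    rw [hθ, h1γ, hγ, hq]; field_simp
  have hθη : θ + η = 1 := by rw [hθ, hη]; field_simp; ring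
  obtain ⟨c₁, hc₁, H₁⟩ := exists_lintegral_min_rpow_le hγ0
  obtain ⟨K, hK, HK⟩ := exists_lintegral_maximalFn_rpow_le μ hρ
  set V : ℝ≥0∞ := μ (ball (0 : E) 3) with hV
  have hVt : V ≠ ∞ := measure_ball_lt_top.ne
  have hρ1 : 0 < 1 - 1 / ρ := by
    rw [sub_pos, div_lt_one hρ0]; exact hρ
  set B : ℝ≥0∞ := c₁ * (V ^ θ * (V ^ (1 - 1 / ρ)) ^ η) with hB
  have hBt : B ≠ ∞ := by rw [hB]; finiteness
  refine ⟨B * K ^ (1 / q), by finiteness, fun u hu => ?_⟩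
  set N : ℝ≥0∞ := (∫⁻ y, ‖u y‖ₑ ^ ρ ∂μ) ^ (1 / ρ) with hN
  set M : E → ℝ≥0∞ := maximalFn μ fun y => ‖u y‖ₑ with hM
  have hvol : ∀ (z : E) (t : ℝ), 0 < t → μ (ball z (t * 3)) = ENNReal.ofReal (t ^ d) * V := by
    intro z t ht
    rw [hV, hd, Real.rpow_natCast, ← μ.addHaar_ball_mul_of_pos z ht]
  have hcancel : ∀ t : ℝ, 0 < t → ∀ s : ℝ,
      ENNReal.ofReal (t ^ (-d)) * ENNReal.ofReal (t ^ s) = ENNReal.ofReal (t ^ (s - d)) := by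
    intro t ht s
    rw [← ENNReal.ofReal_mul (by positivity), ← Real.rpow_add ht]; ring_nf
  have hpt : ∀ z, rieszBall μ (fun y => ‖u y‖ₑ) z ≤ B * (M z ^ θ * N ^ η) := by
    intro z
    calc rieszBall μ (fun y => ‖u y‖ₑ) z
        ≤ ∫⁻ t in Ioc (0 : ℝ) 1, min (V * M z)
            (V ^ (1 - 1 / ρ) * N * ENNReal.ofReal (t ^ (-(1 + γ)))) := by
          refine setLIntegral_mono' measurableSet_Ioc fun t ht => le_min ?_ ?_
          · calc _ ≤ ENNReal.ofReal (t ^ (-d)) * (μ (ball z (t * 3)) * M z) := by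
                  gcongr
                  exact lintegral_ball_le_maximalFn μ _ (mem_ball_self (by linarith [ht.1]))
              _ = V * M z := by
                  rw [hvol z t ht.1, ← mul_assoc, ← mul_assoc, hcancel t ht.1]; simp
          · have hH := eLpNorm'_le_eLpNorm'_mul_rpow_measure_univ (μ := μ.restrict (ball z (t * 3)))
              zero_lt_one hρ.le hu.aestronglyMeasurable
            simp only [eLpNorm'_eq_lintegral_enorm, ENNReal.rpow_one, div_one,
              Measure.restrict_apply_univ] at hH
            calc _ ≤ ENNReal.ofReal (t ^ (-d)) * (N * (ENNReal.ofReal (t ^ d) * V) ^ (1 - 1 / ρ)) := by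
                  gcongr
                  refine hH.trans ?_
                  rw [hvol z t ht.1]
                  gcongr
                  exact ENNReal.rpow_le_rpow (setLIntegral_le_lintegral _ _) (by positivity)
              _ = V ^ (1 - 1 / ρ) * N * (ENNReal.ofReal (t ^ (-d)) *
                    ENNReal.ofReal (t ^ (d * (1 - 1 / ρ)))) := by
                  rw [ENNReal.mul_rpow_of_nonneg _ _ hρ1.le,
                    ENNReal.ofReal_rpow_of_nonneg (Real.rpow_nonneg ht.1.le _) hρ1.le,
                    ← Real.rpow_mul ht.1.le]
                  ring
              _ = _ := by
                  rw [hcancel t ht.1, h1γ]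
                  congr 4
                  ring
      _ ≤ ∫⁻ t in Ioi (0 : ℝ), min (V * M z)
            (V ^ (1 - 1 / ρ) * N * ENNReal.ofReal (t ^ (-(1 + γ)))) :=
          lintegral_mono_set Ioc_subset_Ioi_self
      _ ≤ c₁ * ((V * M z) ^ θ * (V ^ (1 - 1 / ρ) * N) ^ η) := H₁ _ _
      _ = _ := by
          rw [ENNReal.mul_rpow_of_nonneg _ _ hθ0.le, ENNReal.mul_rpow_of_nonneg _ _ hη0.le, hB]
          ring
  clear_value B N
  calc (∫⁻ z, rieszBall μ (fun y => ‖u y‖ₑ) z ^ q ∂μ) ^ (1 / q)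
      ≤ (∫⁻ z, B ^ q * N ^ (η * q) * M z ^ ρ ∂μ) ^ (1 / q) := by
        refine ENNReal.rpow_le_rpow (lintegral_mono fun z => ?_) (by positivity)
        refine (ENNReal.rpow_le_rpow (hpt z) hq0.le).trans (le_of_eq ?_)
        rw [ENNReal.mul_rpow_of_nonneg _ _ hq0.le, ENNReal.mul_rpow_of_nonneg _ _ hq0.le,
          ← ENNReal.rpow_mul, ← ENNReal.rpow_mul, hθq]
        ring
    _ = (B ^ q * N ^ (η * q) * ∫⁻ z, M z ^ ρ ∂μ) ^ (1 / q) := by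
        rw [lintegral_const_mul _ ((measurable_maximalFn μ _).pow_const _)]
    _ ≤ (B ^ q * N ^ (η * q) * (K * N ^ ρ)) ^ (1 / q) := by
        refine ENNReal.rpow_le_rpow ?_ (by positivity)
        gcongr
        refine (HK _ hu.enorm fun x => enorm_ne_top).trans (le_of_eq ?_)
        rw [hN, ← ENNReal.rpow_mul, one_div_mul_cancel hρ0.ne', ENNReal.rpow_one]
    _ = _ := by
        have hq1 : 0 ≤ 1 / q := by positivity
        rw [ENNReal.mul_rpow_of_nonneg _ _ hq1, ENNReal.mul_rpow_of_nonneg _ _ hq1,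
          ENNReal.mul_rpow_of_nonneg _ _ hq1, ← ENNReal.rpow_mul, ← ENNReal.rpow_mul,
          ← ENNReal.rpow_mul, mul_one_div_cancel hq0.ne', ENNReal.rpow_one, mul_assoc η,
          mul_one_div_cancel hq0.ne', mul_one]
        have : ρ * (1 / q) = θ := by rw [← hθq]; field_simp
        rw [this]
        have : N = N ^ θ * N ^ η := by
          rw [← ENNReal.rpow_add_of_nonneg _ _ hθ0.le hη0.le, hθη, ENNReal.rpow_one]
        nth_rewrite 3 [this]
        ring

end Riesz

section Annulus

set_option linter.unusedSectionVars false

variable {E : Type*} [NormedAddCommGroup E] [NormedSpace ℝ E] [FiniteDimensional ℝ E]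
  [MeasurableSpace E] [BorelSpace E] (μ : Measure E) [μ.IsAddHaarMeasure] {Ω : E → ℝ}

theorem enorm_div_pow_le_of_mem_unitAnnulus (m : ℕ) {y : E} (hy : y ∈ unitAnnulus E) :
    ‖Ω y / ‖y‖ ^ m‖ₑ ≤ ‖Ω y‖ₑ := by
  rw [enorm_le_iff_norm_le, norm_div, norm_pow, norm_norm]
  exact div_le_self (norm_nonneg _) (one_le_pow₀ hy.1.le)

/-- Poincaré-type estimate for mean zero kernels on the unit annulus. -/
theorem enorm_setIntegral_unitAnnulus_mul_le [Nontrivial E] (m : ℕ) (hΩm : Measurable Ω)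
    (hΩ : ∀ c : ℝ, 0 < c → ∀ y, Ω (c • y) = Ω y)
    (h_int : Integrable (fun z : sphere (0 : E) 1 => Ω z) μ.toSphere)
    (hzero : ∫ z : sphere (0 : E) 1, Ω z ∂μ.toSphere = 0)
    {F : E → ℝ} (hF : Differentiable ℝ F) :
    ‖∫ y in unitAnnulus E, Ω y / ‖y‖ ^ m * F y ∂μ‖ₑ * μ (ball 0 1) ≤
      ∫⁻ y in unitAnnulus E, ‖Ω y‖ₑ * (ENNReal.ofReal 3 *
        rieszBall μ (fun z => ‖fderiv ℝ F z‖ₑ) y) ∂μ := by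
  have hA := measurableSet_unitAnnulus (E := E)
  obtain ⟨hk, hk0⟩ := integrableOn_unitAnnulus_and_integral_eq_zero μ m hΩ h_int hzero
  have hFm : Measurable F := hF.continuous.measurable
  have hw : ∀ w, ‖∫ y in unitAnnulus E, Ω y / ‖y‖ ^ m * F y ∂μ‖ₑ ≤
      ∫⁻ y in unitAnnulus E, ‖Ω y‖ₑ * ‖F y - F w‖ₑ ∂μ := by
    intro w
    by_cases hi : IntegrableOn (fun y => Ω y / ‖y‖ ^ m * F y) (unitAnnulus E) μ
    · have : ∫ y in unitAnnulus E, Ω y / ‖y‖ ^ m * F y ∂μ =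
          ∫ y in unitAnnulus E, Ω y / ‖y‖ ^ m * (F y - F w) ∂μ := by
        simp_rw [mul_sub]
        rw [integral_sub hi (hk.mul_const _), integral_mul_const, hk0]
        simp
      rw [this]
      refine (enorm_integral_le_lintegral_enorm _).trans (setLIntegral_mono' hA fun y hy => ?_)
      rw [enorm_mul]
      gcongr
      exact enorm_div_pow_le_of_mem_unitAnnulus m hy
    · rw [integral_undef hi]; simp
  have hmeas : Measurable fun p : E × E => ‖Ω p.2‖ₑ * ‖F p.2 - F p.1‖ₑ := by fun_prop
  calc ‖∫ y in unitAnnulus E, Ω y / ‖y‖ ^ m * F y ∂μ‖ₑ * μ (ball 0 1)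
      = ∫⁻ _ in ball (0 : E) 1, ‖∫ y in unitAnnulus E, Ω y / ‖y‖ ^ m * F y ∂μ‖ₑ ∂μ := by
        rw [setLIntegral_const]
    _ ≤ ∫⁻ w in ball (0 : E) 1, ∫⁻ y in unitAnnulus E, ‖Ω y‖ₑ * ‖F y - F w‖ₑ ∂μ ∂μ :=
        lintegral_mono fun w => hw w
    _ = ∫⁻ y in unitAnnulus E, ∫⁻ w in ball (0 : E) 1, ‖Ω y‖ₑ * ‖F y - F w‖ₑ ∂μ ∂μ :=
        lintegral_lintegral_swap hmeas.aemeasurable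
    _ ≤ _ := by
        refine setLIntegral_mono' hA fun y hy => ?_
        rw [lintegral_const_mul' _ _ enorm_ne_top]
        gcongr
        refine (lintegral_mono_set ?_).trans (lintegral_ball_enorm_sub_le μ hF y)
        intro w hw
        rw [mem_ball_zero_iff] at hw
        rw [mem_ball, dist_eq_norm]
        linarith [norm_sub_le w y, hy.2]

/-- The annulus estimate with the gradient in `L^α` and the kernel in `L^ρ`. -/
theorem exists_enorm_setIntegral_unitAnnulus_mul_le [Nontrivial E] (m : ℕ) {ρ α : ℝ} (hρ : 1 < ρ)
    (hρd : ρ < Module.finrank ℝ E)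
    (hα : ρ * Module.finrank ℝ E / (ρ * Module.finrank ℝ E + ρ - Module.finrank ℝ E) ≤ α) :
    ∃ c : ℝ≥0∞, c ≠ ∞ ∧ ∀ Ω : E → ℝ, Measurable Ω → (∀ c : ℝ, 0 < c → ∀ y, Ω (c • y) = Ω y) →
      Integrable (fun z : sphere (0 : E) 1 => Ω z) μ.toSphere →
      ∫ z : sphere (0 : E) 1, Ω z ∂μ.toSphere = 0 → ∀ F : E → ℝ, Differentiable ℝ F →
      ‖∫ y in unitAnnulus E, Ω y / ‖y‖ ^ m * F y ∂μ‖ₑ ≤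
        c * ((∫⁻ z : sphere (0 : E) 1, ‖Ω z‖ₑ ^ ρ ∂μ.toSphere) ^ (1 / ρ) *
          (∫⁻ z in ball (0 : E) 5, ‖fderiv ℝ F z‖ₑ ^ α ∂μ) ^ (1 / α)) := by
  set d : ℝ := (Module.finrank ℝ E : ℝ) with hd
  have hd0 : 0 < d := by linarith
  have hρ0 : 0 < ρ := by linarith
  have hdρ : 0 < d - ρ := by linarith
  have hden : 0 < ρ * d + ρ - d := by nlinarith
  set q : ℝ := d * ρ / (d - ρ) with hq
  set p : ℝ := ρ * d / (ρ * d + ρ - d) with hp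
  have hp0 : 0 < p := by positivity
  have hpq : p.HolderConjugate q := by
    rw [Real.holderConjugate_iff]
    refine ⟨?_, ?_⟩
    · rw [hp, one_lt_div hden]; linarith
    · rw [hp, hq]; field_simp; ring
  obtain ⟨c₁, hc₁, H₁⟩ := exists_lintegral_rieszBall_rpow_le μ hρ hρd
  obtain ⟨c₂, hc₂, H₂⟩ := exists_lintegral_unitAnnulus_le μ ρ
  set V : ℝ≥0∞ := μ (ball (0 : E) 1) with hV
  have hV0 : V ≠ 0 := (measure_ball_pos μ 0 one_pos).ne'
  have hVt : V ≠ ∞ := measure_ball_lt_top.ne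
  set W : ℝ≥0∞ := μ (ball (0 : E) 5) with hW
  have hWt : W ≠ ∞ := measure_ball_lt_top.ne
  have hpα : 0 ≤ 1 / p - 1 / α := by
    rw [sub_nonneg]; exact one_div_le_one_div_of_le hp0 hα
  refine ⟨ENNReal.ofReal 3 * W ^ (1 / p - 1 / α) * c₁ * c₂ ^ (1 / ρ) / V, ?_,
    fun Ω hΩm hΩ h_int hzero F hF => ?_⟩
  · refine ENNReal.div_ne_top ?_ hV0
    have := ENNReal.rpow_ne_top_of_nonneg hpα hWt
    finiteness
  have hA := measurableSet_unitAnnulus (E := E)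
  have hB := measurableSet_ball (x := (0 : E)) (ε := 5)
  have hDm : Measurable fun z => ‖fderiv ℝ F z‖ₑ := (measurable_fderiv ℝ F).enorm
  set D : E → ℝ≥0∞ := (ball (0 : E) 5).indicator fun z => ‖fderiv ℝ F z‖ₑ with hD
  set u : E → ℝ := (unitAnnulus E).indicator Ω with hu
  have hum : Measurable u := hΩm.indicator hA
  have huE : (fun y => ‖u y‖ₑ) = (unitAnnulus E).indicator fun y => ‖Ω y‖ₑ := by
    funext y; rw [hu, enorm_indicator_eq_indicator_enorm]
  have hD_m : Measurable D := hDm.indicator hB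
  set S : ℝ≥0∞ := ∫⁻ z : sphere (0 : E) 1, ‖Ω z‖ₑ ^ ρ ∂μ.toSphere with hS
  have huρ : ∫⁻ y, ‖u y‖ₑ ^ ρ ∂μ = c₂ * S := by
    rw [hS, ← H₂ Ω hΩm hΩ, ← lintegral_indicator hA]
    refine lintegral_congr fun y => ?_
    rw [show ‖u y‖ₑ = (unitAnnulus E).indicator (fun y => ‖Ω y‖ₑ) y from congrFun huE y]
    by_cases hy : y ∈ unitAnnulus E
    · simp [hy]
    · simp [hy, hρ0]
  have hDp : (∫⁻ z, D z ^ p ∂μ) ^ (1 / p) ≤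
      (∫⁻ z in ball (0 : E) 5, ‖fderiv ℝ F z‖ₑ ^ α ∂μ) ^ (1 / α) * W ^ (1 / p - 1 / α) := by
    have hH := eLpNorm'_le_eLpNorm'_mul_rpow_measure_univ (μ := μ.restrict (ball (0 : E) 5))
      hp0 hα (measurable_fderiv ℝ F).aestronglyMeasurable
    simp only [eLpNorm'_eq_lintegral_enorm, Measure.restrict_apply_univ] at hH
    refine le_of_eq_of_le ?_ hH
    rw [← lintegral_indicator hB]
    congr 1
    refine lintegral_congr fun y => ?_
    by_cases hy : y ∈ ball (0 : E) 5
    · rw [hD, indicator_of_mem hy, indicator_of_mem hy]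
    · rw [hD, indicator_of_notMem hy, indicator_of_notMem hy, ENNReal.zero_rpow_of_pos hp0]
  rw [← ENNReal.mul_div_right_comm, ENNReal.le_div_iff_mul_le (Or.inl hV0) (Or.inl hVt)]
  calc _ ≤ ∫⁻ y in unitAnnulus E, ‖Ω y‖ₑ * (ENNReal.ofReal 3 *
        rieszBall μ (fun z => ‖fderiv ℝ F z‖ₑ) y) ∂μ :=
        enorm_setIntegral_unitAnnulus_mul_le μ m hΩm hΩ h_int hzero hF
    _ = ∫⁻ y in unitAnnulus E, ‖Ω y‖ₑ * (ENNReal.ofReal 3 * rieszBall μ D y) ∂μ := by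
        refine setLIntegral_congr_fun hA fun y hy => ?_
        congr 2
        unfold rieszBall
        refine setLIntegral_congr_fun measurableSet_Ioc fun t ht => ?_
        congr 1
        refine setLIntegral_congr_fun measurableSet_ball fun z hz => ?_
        rw [hD, indicator_of_mem]
        rw [mem_ball_zero_iff]
        rw [mem_ball, dist_eq_norm] at hz
        have := norm_sub_norm_le z y
        linarith [hy.2, ht.2]
    _ = ENNReal.ofReal 3 * ∫⁻ y, ‖u y‖ₑ * rieszBall μ D y ∂μ := by
        rw [← lintegral_const_mul' _ _ ENNReal.ofReal_ne_top, ← lintegral_indicator hA]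
        refine lintegral_congr fun y => ?_
        rw [show ‖u y‖ₑ = (unitAnnulus E).indicator (fun y => ‖Ω y‖ₑ) y from congrFun huE y]
        by_cases hy : y ∈ unitAnnulus E
        · simp only [indicator_of_mem hy]; ring
        · simp [indicator_of_notMem hy]
    _ = ENNReal.ofReal 3 * ∫⁻ z, (D * rieszBall μ fun y => ‖u y‖ₑ) z ∂μ := by
        rw [lintegral_mul_rieszBall_comm μ hum.enorm hD_m]; rfl
    _ ≤ ENNReal.ofReal 3 *
          (((∫⁻ z in ball (0 : E) 5, ‖fderiv ℝ F z‖ₑ ^ α ∂μ) ^ (1 / α) * W ^ (1 / p - 1 / α)) *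
            (c₁ * (c₂ ^ (1 / ρ) * S ^ (1 / ρ)))) := by
        gcongr
        refine (ENNReal.lintegral_mul_le_Lp_mul_Lq μ hpq hD_m.aemeasurable
          (measurable_rieszBall μ hum.enorm).aemeasurable).trans ?_
        refine mul_le_mul' hDp ((H₁ u hum).trans (le_of_eq ?_))
        rw [huρ, ENNReal.mul_rpow_of_nonneg _ _ (by positivity)]
    _ = _ := by ring

end Annulus

section Pointwise

set_option linter.unusedSectionVars false

variable {E : Type*} [NormedAddCommGroup E] [NormedSpace ℝ E] [FiniteDimensional ℝ E]
  [MeasurableSpace E] [BorelSpace E] (μ : Measure E) [μ.IsAddHaarMeasure]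

/-- Measurable functions, homogeneous of degree zero, integrable with mean zero on the sphere. -/
structure IsMeanZeroKernel (Ω : E → ℝ) : Prop where
  measurable : Measurable Ω
  map_smul : ∀ c : ℝ, 0 < c → ∀ y, Ω (c • y) = Ω y
  integrable : Integrable (fun z : sphere (0 : E) 1 => Ω z) μ.toSphere
  integral_eq_zero : ∫ z : sphere (0 : E) 1, Ω z ∂μ.toSphere = 0

open scoped Pointwise in
theorem setIntegral_annulus_eq {Ω : E → ℝ} (hΩ : ∀ c : ℝ, 0 < c → ∀ y, Ω (c • y) = Ω y)
    (f : E → ℝ) (x : E) {R : ℝ} (hR : 0 < R) :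
    ∫ y in {y : E | R < ‖y‖ ∧ ‖y‖ ≤ R * 2}, Ω y / ‖y‖ ^ Module.finrank ℝ E * f (x - y) ∂μ =
      ∫ y in unitAnnulus E, Ω y / ‖y‖ ^ Module.finrank ℝ E * f (x + (-R) • y) ∂μ := by
  have hset : R • unitAnnulus E = {y : E | R < ‖y‖ ∧ ‖y‖ ≤ R * 2} := by
    ext y
    rw [mem_smul_set_iff_inv_smul_mem₀ hR.ne']
    simp only [unitAnnulus, mem_ofPred_eq, norm_smul, norm_inv, Real.norm_eq_abs, abs_of_pos hR]
    rw [inv_mul_le_iff₀ hR, lt_inv_mul_iff₀ hR, mul_one]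
  have h := Measure.setIntegral_comp_smul_of_pos μ
    (fun y => Ω y / ‖y‖ ^ Module.finrank ℝ E * f (x - y)) (unitAnnulus E) hR
  rw [hset] at h
  have hRd : R ^ Module.finrank ℝ E ≠ 0 := by positivity
  rw [eq_inv_smul_iff₀ hRd, ← integral_smul] at h
  rw [← h]
  congr 1
  funext y
  rw [hΩ R hR, norm_smul, Real.norm_eq_abs, abs_of_pos hR, mul_pow, smul_eq_mul, neg_smul,
    ← sub_eq_add_neg]
  field_simp

theorem setLIntegral_enorm_fderiv_comp_rpow {f : E → ℝ} (hf : Differentiable ℝ f) {α : ℝ}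
    (hα : 0 < α) (x : E) {R : ℝ} (hR : 0 < R) :
    (∫⁻ u in ball (0 : E) 5, ‖fderiv ℝ (fun u => f (x + (-R) • u)) u‖ₑ ^ α ∂μ) ^ (1 / α) =
      ENNReal.ofReal R * (ENNReal.ofReal (R ^ (-(Module.finrank ℝ E : ℝ))) *
        ∫⁻ z in ball x (R * 5), ‖fderiv ℝ f z‖ₑ ^ α ∂μ) ^ (1 / α) := by
  have hfd : ∀ u, ‖fderiv ℝ (fun u => f (x + (-R) • u)) u‖ₑ =
      ENNReal.ofReal R * ‖fderiv ℝ f (x + (-R) • u)‖ₑ := by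
    intro u
    have h1 : HasFDerivAt (fun u : E => x + (-R) • u) ((-R) • ContinuousLinearMap.id ℝ E) u :=
      ((hasFDerivAt_id u).const_smul (-R)).const_add x
    have h2 := ((hf (x + (-R) • u)).hasFDerivAt.comp u h1).fderiv
    rw [show (fun u => f (x + (-R) • u)) = f ∘ fun u : E => x + (-R) • u from rfl, h2,
      ContinuousLinearMap.comp_smul, ContinuousLinearMap.comp_id, enorm_smul,
      enorm_neg, Real.enorm_of_nonneg hR.le]
  have hm : Measurable fun z => ‖fderiv ℝ f z‖ₑ ^ α := (measurable_fderiv ℝ f).enorm.pow_const _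
  have h := lintegral_comp_add_smul μ (hm.indicator (measurableSet_ball (x := x) (ε := R * 5))) x
    (neg_ne_zero.2 hR.ne')
  rw [lintegral_indicator measurableSet_ball] at h
  have hind : ∀ u, (ball x (R * 5)).indicator (fun z => ‖fderiv ℝ f z‖ₑ ^ α) (x + (-R) • u) =
      (ball (0 : E) 5).indicator (fun u => ‖fderiv ℝ f (x + (-R) • u)‖ₑ ^ α) u := by
    intro u
    have hiff : x + (-R) • u ∈ ball x (R * 5) ↔ u ∈ ball (0 : E) 5 := by
      rw [mem_ball, dist_eq_norm, add_sub_cancel_left, norm_smul, norm_neg, Real.norm_eq_abs,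
        abs_of_pos hR, mem_ball_zero_iff, mul_lt_mul_iff_right₀ hR]
    by_cases hu : u ∈ ball (0 : E) 5
    · rw [indicator_of_mem hu, indicator_of_mem (hiff.2 hu)]
    · rw [indicator_of_notMem hu, indicator_of_notMem (fun h => hu (hiff.1 h))]
  simp_rw [hind] at h
  rw [lintegral_indicator measurableSet_ball, abs_inv, abs_pow, abs_neg, abs_of_pos hR,
    ← Real.rpow_natCast, ← Real.rpow_neg hR.le] at h
  simp_rw [hfd, ENNReal.mul_rpow_of_nonneg _ _ hα.le]
  rw [lintegral_const_mul' _ _ (by finiteness), h, ENNReal.mul_rpow_of_nonneg _ _ (by positivity),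
    ← ENNReal.rpow_mul, mul_one_div_cancel hα.ne', ENNReal.rpow_one]

theorem hasSum_setIntegral_dyadic {k : E → ℝ} {t : ℝ} (ht : 0 < t)
    (hk : IntegrableOn k {y : E | t < ‖y‖} μ) :
    HasSum (fun j : ℕ => ∫ y in {y : E | t * 2 ^ j < ‖y‖ ∧ ‖y‖ ≤ t * 2 ^ j * 2}, k y ∂μ)
      (∫ y in {y : E | t < ‖y‖}, k y ∂μ) := by
  have hmono : Monotone fun j : ℕ => t * 2 ^ j := fun i j hij => by
    simp only; gcongr; norm_num
  have hU : {y : E | t < ‖y‖} =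
      ⋃ j : ℕ, {y : E | t * 2 ^ j < ‖y‖ ∧ ‖y‖ ≤ t * 2 ^ j * 2} := by
    have hun : ¬ BddAbove (range fun j : ℕ => t * 2 ^ j) := by
      rintro ⟨b, hb⟩
      obtain ⟨j, hj⟩ := pow_unbounded_of_one_lt (b / t) (one_lt_two (α := ℝ))
      have := hb ⟨j, rfl⟩
      rw [div_lt_iff₀ ht] at hj
      simp only at this
      linarith
    have := iUnion_Ioc_map_succ_eq_Ioi (fun a => hmono bot_le) hun
    ext y
    have h2 := Set.ext_iff.1 this ‖y‖
    simpa [pow_succ, mul_assoc] using h2.symm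
  have hd : Pairwise (Function.onFun Disjoint
      fun j : ℕ => {y : E | t * 2 ^ j < ‖y‖ ∧ ‖y‖ ≤ t * 2 ^ j * 2}) := by
    intro i j hij
    have h := hmono.pairwise_disjoint_on_Ioc_succ hij
    rw [Function.onFun, Set.disjoint_left] at h ⊢
    intro y hi hj
    exact h (a := ‖y‖) (by simpa [pow_succ, mul_assoc] using hi)
      (by simpa [pow_succ, mul_assoc] using hj)
  rw [hU] at hk ⊢
  refine hasSum_integral_iUnion (fun j => ?_) hd hk
  exact (measurableSet_lt measurable_const measurable_norm).inter
    (measurableSet_le measurable_norm measurable_const)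

theorem tsum_lintegral_dyadic_le (φ : ℝ → ℝ≥0∞) {t : ℝ} (ht : 0 < t) :
    ∑' j : ℕ, ∫⁻ r in Ioc (t * 2 ^ j) (t * 2 ^ j * 2), φ r ≤ ∫⁻ r in Ioi 0, φ r := by
  have hmono : Monotone fun j : ℕ => t * 2 ^ j := fun i j hij => by
    simp only; gcongr; norm_num
  have hd : Pairwise (Function.onFun Disjoint
      fun j : ℕ => Ioc (t * 2 ^ j) (t * 2 ^ j * 2)) := by
    have := hmono.pairwise_disjoint_on_Ioc_succ
    simpa [pow_succ, mul_assoc] using this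
  rw [← lintegral_iUnion (fun j => measurableSet_Ioc) hd]
  refine lintegral_mono_set (iUnion_subset fun j r hr => ?_)
  exact lt_trans (by positivity : 0 < t * 2 ^ j) hr.1

end Pointwise

section Truncated

set_option linter.unusedSectionVars false

variable {E : Type*} [NormedAddCommGroup E] [NormedSpace ℝ E] [FiniteDimensional ℝ E]
  [MeasurableSpace E] [BorelSpace E] (μ : Measure E) [μ.IsAddHaarMeasure]

theorem ofReal_mul_rpow_le_lintegral_min {α β : ℝ} (hα : 0 < α) (hαβ : α < β) {h : E → ℝ≥0∞}
    {N : ℝ≥0∞} {x : E}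
    (hN : ∀ r : ℝ, 0 < r → (ENNReal.ofReal (r ^ (-((Module.finrank ℝ E : ℝ) - β))) *
      ∫⁻ y in ball x r, h y ∂μ) ^ (1 / α) ≤ N) {R : ℝ} (hR : 0 < R) :
    ENNReal.ofReal R * (ENNReal.ofReal (R ^ (-(Module.finrank ℝ E : ℝ))) *
        ∫⁻ z in ball x (R * 5), h z ∂μ) ^ (1 / α) ≤
      ∫⁻ r in Ioc R (R * 2), min ((μ (ball (0 : E) 5) * maximalFn μ h x) ^ (1 / α))
        (ENNReal.ofReal (5 ^ (((Module.finrank ℝ E : ℝ) - β) / α) * 2 ^ (β / α)) * N *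
          ENNReal.ofReal (r ^ (-(β / α)))) := by
  set d : ℝ := (Module.finrank ℝ E : ℝ) with hd
  have hα' : 0 ≤ 1 / α := by positivity
  set I := ∫⁻ z in ball x (R * 5), h z ∂μ with hI
  have hvol : ENNReal.ofReal R = volume (Ioc R (R * 2)) := by
    rw [Real.volume_Ioc]; congr 1; ring
  rw [mul_comm, hvol, ← setLIntegral_const]
  refine setLIntegral_mono' measurableSet_Ioc fun r hr => le_min ?_ ?_
  · refine ENNReal.rpow_le_rpow ?_ hα'
    calc ENNReal.ofReal (R ^ (-d)) * I
        ≤ ENNReal.ofReal (R ^ (-d)) * (ENNReal.ofReal (R ^ d) * μ (ball 0 5) *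
            maximalFn μ h x) := by
          gcongr
          refine (lintegral_ball_le_maximalFn μ h (mem_ball_self (by positivity))).trans_eq ?_
          rw [Measure.addHaar_ball_mul_of_pos μ x hR, hd, Real.rpow_natCast]
      _ = ENNReal.ofReal (R ^ (-d) * R ^ d) * (μ (ball 0 5) * maximalFn μ h x) := by
          rw [ENNReal.ofReal_mul (by positivity)]; ring
      _ = _ := by rw [← Real.rpow_add hR]; simp
  · have hr0 : 0 < r := hR.trans hr.1
    have h5 : 0 < R * 5 := by positivity
    have hreal : (R ^ (-d) * (R * 5) ^ (d - β)) ^ (1 / α) ≤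
        5 ^ ((d - β) / α) * 2 ^ (β / α) * r ^ (-(β / α)) := by
      have h1 : R ^ (-d) * (R * 5) ^ (d - β) = 5 ^ (d - β) * R ^ (-β) := by
        rw [Real.mul_rpow hR.le (by norm_num), ← mul_assoc, ← Real.rpow_add hR, mul_comm]
        congr 2; ring
      have h2 : R ^ (-(β / α)) = 2 ^ (β / α) * (R * 2) ^ (-(β / α)) := by
        rw [Real.mul_rpow hR.le (by norm_num), mul_left_comm, ← Real.rpow_add two_pos]
        simp
      have h3 : (R * 2) ^ (-(β / α)) ≤ r ^ (-(β / α)) :=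
        Real.rpow_le_rpow_of_nonpos hr0 hr.2 (by
          rw [neg_nonpos]; exact div_nonneg (hα.trans hαβ).le hα.le)
      rw [h1, Real.mul_rpow (by positivity) (by positivity), ← Real.rpow_mul (by norm_num),
        ← Real.rpow_mul hR.le, mul_one_div, mul_one_div, neg_div, h2, mul_assoc]
      gcongr
    calc (ENNReal.ofReal (R ^ (-d)) * I) ^ (1 / α)
        = (ENNReal.ofReal (R ^ (-d) * (R * 5) ^ (d - β)) *
            (ENNReal.ofReal ((R * 5) ^ (-(d - β))) * I)) ^ (1 / α) := by
          rw [← mul_assoc, ← ENNReal.ofReal_mul (by positivity), mul_assoc,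
            ← Real.rpow_add h5]
          simp
      _ = ENNReal.ofReal ((R ^ (-d) * (R * 5) ^ (d - β)) ^ (1 / α)) *
            (ENNReal.ofReal ((R * 5) ^ (-(d - β))) * I) ^ (1 / α) := by
          rw [ENNReal.mul_rpow_of_nonneg _ _ hα', ENNReal.ofReal_rpow_of_nonneg (by positivity) hα']
      _ ≤ ENNReal.ofReal (5 ^ ((d - β) / α) * 2 ^ (β / α) * r ^ (-(β / α))) * N := by
          gcongr
          exact hN _ h5
      _ = _ := by
          rw [ENNReal.ofReal_mul (by positivity)]; ring

/-- Pointwise bound for truncated rough singular integrals by the maximal function of the gradient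
and its Morrey norm. -/
theorem exists_enorm_setIntegral_truncated_le [Nontrivial E] {ρ α β : ℝ} (hρ : 1 < ρ)
    (hρd : ρ < Module.finrank ℝ E)
    (hρα : ρ * Module.finrank ℝ E / (ρ * Module.finrank ℝ E + ρ - Module.finrank ℝ E) ≤ α)
    (hα : 0 < α) (hαβ : α < β) :
    ∃ c : ℝ≥0∞, c ≠ ∞ ∧ ∀ Ω : E → ℝ, IsMeanZeroKernel μ Ω → ∀ f : E → ℝ, Differentiable ℝ f →
      ∀ N : ℝ≥0∞, (∀ (x : E) (r : ℝ), 0 < r →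
        (ENNReal.ofReal (r ^ (-((Module.finrank ℝ E : ℝ) - β))) *
          ∫⁻ y in ball x r, ‖fderiv ℝ f y‖ₑ ^ α ∂μ) ^ (1 / α) ≤ N) →
      ∀ (x : E) (t : ℝ), 0 < t →
        ‖∫ y in {y : E | t < ‖y‖}, Ω y / ‖y‖ ^ Module.finrank ℝ E * f (x - y) ∂μ‖ₑ ≤
          c * (∫⁻ z : sphere (0 : E) 1, ‖Ω z‖ₑ ^ ρ ∂μ.toSphere) ^ (1 / ρ) * N ^ (α / β) *
            maximalFn μ (fun y => ‖fderiv ℝ f y‖ₑ ^ α) x ^ (1 / α - 1 / β) := by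
  have hβ0 : 0 < β := hα.trans hαβ
  have hγ0 : 0 < β / α - 1 := by rw [sub_pos, one_lt_div hα]; exact hαβ
  obtain ⟨c₁, hc₁, H₁⟩ :=
    exists_enorm_setIntegral_unitAnnulus_mul_le μ (Module.finrank ℝ E) hρ hρd hρα
  obtain ⟨c₂, hc₂, H₂⟩ := exists_lintegral_min_rpow_le hγ0
  set d : ℝ := (Module.finrank ℝ E : ℝ) with hd
  set V : ℝ≥0∞ := μ (ball (0 : E) 5) with hV
  have hVt : V ≠ ∞ := measure_ball_lt_top.ne
  set k : ℝ≥0∞ := ENNReal.ofReal (5 ^ ((d - β) / α) * 2 ^ (β / α)) with hk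
  have hσ : 0 ≤ 1 / α - 1 / β := by
    rw [sub_nonneg]; exact one_div_le_one_div_of_le hα hαβ.le
  have hαβ' : 0 ≤ α / β := by positivity
  have hkt : k ^ (α / β) ≠ ∞ := ENNReal.rpow_ne_top_of_nonneg hαβ' ENNReal.ofReal_ne_top
  have hVσ : V ^ (1 / α - 1 / β) ≠ ∞ := ENNReal.rpow_ne_top_of_nonneg hσ hVt
  refine ⟨c₁ * c₂ * V ^ (1 / α - 1 / β) * k ^ (α / β), by finiteness,
    fun Ω hΩ f hf N hN x t ht => ?_⟩
  set S : ℝ≥0∞ := (∫⁻ z : sphere (0 : E) 1, ‖Ω z‖ₑ ^ ρ ∂μ.toSphere) ^ (1 / ρ) with hS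
  set h : E → ℝ≥0∞ := fun y => ‖fderiv ℝ f y‖ₑ ^ α with hh
  set φ : ℝ → ℝ≥0∞ := fun r => min ((V * maximalFn μ h x) ^ (1 / α))
    (k * N * ENNReal.ofReal (r ^ (-(β / α)))) with hφ
  by_cases hi : IntegrableOn (fun y => Ω y / ‖y‖ ^ Module.finrank ℝ E * f (x - y))
      {y : E | t < ‖y‖} μ
  swap
  · rw [integral_undef hi]; simp
  rw [← (hasSum_setIntegral_dyadic μ ht hi).tsum_eq]
  calc _ ≤ ∑' j : ℕ, ‖∫ y in {y : E | t * 2 ^ j < ‖y‖ ∧ ‖y‖ ≤ t * 2 ^ j * 2},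
        Ω y / ‖y‖ ^ Module.finrank ℝ E * f (x - y) ∂μ‖ₑ := enorm_tsum_le_tsum_enorm
    _ ≤ ∑' j : ℕ, c₁ * S * ∫⁻ r in Ioc (t * 2 ^ j) (t * 2 ^ j * 2), φ r := by
        refine ENNReal.tsum_le_tsum fun j => ?_
        have hR : 0 < t * 2 ^ j := by positivity
        rw [setIntegral_annulus_eq μ hΩ.map_smul f x hR]
        refine (H₁ Ω hΩ.measurable hΩ.map_smul hΩ.integrable hΩ.integral_eq_zero
          (fun u => f (x + (-(t * 2 ^ j)) • u)) (hf.comp (by fun_prop))).trans ?_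
        rw [setLIntegral_enorm_fderiv_comp_rpow μ hf hα x hR, ← mul_assoc]
        gcongr
        exact ofReal_mul_rpow_le_lintegral_min μ hα hαβ (hN x) hR
    _ ≤ c₁ * S * ∫⁻ r in Ioi 0, φ r := by
        rw [ENNReal.tsum_mul_left]
        gcongr
        exact tsum_lintegral_dyadic_le φ ht
    _ ≤ c₁ * S * (c₂ * ((V * maximalFn μ h x) ^ (1 / α - 1 / β) * (k * N) ^ (α / β))) := by
        gcongr
        have := H₂ ((V * maximalFn μ h x) ^ (1 / α)) (k * N)
        rw [add_sub_cancel, ← ENNReal.rpow_mul, one_div_div,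
          show 1 / α * ((β / α - 1) / (β / α)) = 1 / α - 1 / β by field_simp] at this
        exact this
    _ = _ := by
        rw [ENNReal.mul_rpow_of_nonneg _ _ hσ, ENNReal.mul_rpow_of_nonneg _ _ hαβ']
        ring

end Truncated

section Orlicz

theorem IsYoung.monotoneOn {A : ℝ → ℝ} (hA : IsYoung A) : MonotoneOn A (Ici 0) := by
  obtain ⟨a, hmono, -, hpos, -, h_int⟩ := hA
  have hii : ∀ t, 0 ≤ t → IntervalIntegrable a volume 0 t := fun t ht => by
    refine MonotoneOn.intervalIntegrable fun x hx y _ hxy => hmono x y ?_ hxy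
    rw [uIcc_of_le ht] at hx
    exact hx.1
  intro s hs t ht hst
  rw [h_int s hs, h_int t ht, ← sub_nonneg,
    intervalIntegral.integral_interval_sub_left (hii t ht) (hii s hs)]
  exact intervalIntegral.integral_nonneg hst fun u hu => hpos u (le_trans hs hu.1)

theorem IsYoung.map_zero {A : ℝ → ℝ} (hA : IsYoung A) : A 0 = 0 := by
  obtain ⟨a, -, -, -, -, h_int⟩ := hA
  rw [h_int 0 le_rfl, intervalIntegral.integral_same]

/-- The monotone extension to `[0, ∞]` of a function on `[0, ∞)`. -/
noncomputable def ennrealExtend (B : ℝ → ℝ) (t : ℝ≥0∞) : ℝ≥0∞ :=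
  ⨆ (r : ℝ) (_ : 0 ≤ r) (_ : ENNReal.ofReal r ≤ t), ENNReal.ofReal (B r)

theorem ofReal_le_ennrealExtend (B : ℝ → ℝ) {r : ℝ} {t : ℝ≥0∞} (hr : 0 ≤ r)
    (hrt : ENNReal.ofReal r ≤ t) : ENNReal.ofReal (B r) ≤ ennrealExtend B t :=
  le_iSup_of_le r (le_iSup_of_le hr (le_iSup_of_le hrt le_rfl))

theorem ennrealExtend_mono (B : ℝ → ℝ) : Monotone (ennrealExtend B) := fun _ _ hst =>
  iSup_le fun _ => iSup_le fun hr => iSup_le fun hrt =>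
    ofReal_le_ennrealExtend B hr (hrt.trans hst)

theorem ennrealExtend_ofReal {B : ℝ → ℝ} (hB : MonotoneOn B (Ici 0)) {r : ℝ} (hr : 0 ≤ r) :
    ennrealExtend B (ENNReal.ofReal r) = ENNReal.ofReal (B r) :=
  le_antisymm (iSup_le fun _ => iSup_le fun hs => iSup_le fun hsr =>
    ENNReal.ofReal_le_ofReal (hB hs hr ((ENNReal.ofReal_le_ofReal_iff hr).1 hsr)))
    (ofReal_le_ennrealExtend B hr le_rfl)

theorem ennrealExtend_top_le (B : ℝ → ℝ) {C : ℝ≥0∞} (hC : 1 < C) :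
    ennrealExtend B ∞ ≤ ⨆ k : ℕ, ennrealExtend B (C ^ k) := by
  refine iSup_le fun r => iSup_le fun hr => iSup_le fun _ => ?_
  have ht : Tendsto (fun k : ℕ => C ^ k) atTop (nhds ∞) := ENNReal.tendsto_pow_atTop_nhds_top_iff.2 hC
  obtain ⟨k, hk⟩ := (ht.eventually (lt_mem_nhds (ENNReal.ofReal_lt_top (r := r)))).exists
  exact (ofReal_le_ennrealExtend B hr hk.le).trans (le_iSup (fun k => ennrealExtend B (C ^ k)) k)

theorem mul_ennrealExtend_le {B : ℝ → ℝ} {C : ℝ} (hC : 0 < C)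
    (hB : ∀ r : ℝ, 0 ≤ r → B r ≤ B (C * r) / (2 * C)) (t : ℝ≥0∞) :
    2 * ENNReal.ofReal C * ennrealExtend B t ≤ ennrealExtend B (ENNReal.ofReal C * t) := by
  simp only [ennrealExtend, ENNReal.mul_iSup]
  refine iSup_le fun r => iSup_le fun hr => iSup_le fun hrt => ?_
  refine le_trans ?_ (ofReal_le_ennrealExtend B (r := C * r) (by positivity) ?_)
  · have h := hB r hr
    rw [le_div_iff₀ (by positivity)] at h
    rw [← ENNReal.ofReal_ofNat, ← ENNReal.ofReal_mul (by norm_num),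
      ← ENNReal.ofReal_mul (by positivity)]
    exact ENNReal.ofReal_le_ofReal (by linarith)
  · rw [ENNReal.ofReal_mul hC.le]
    gcongr

theorem Nabla2.exists_le {B : ℝ → ℝ} (hB : Nabla2 B) {r₀ : ℝ} (hr₀ : 0 ≤ r₀) (hpos : 0 < B r₀)
    (M : ℝ) : ∃ r, 0 ≤ r ∧ M ≤ B r := by
  obtain ⟨C, hC, h⟩ := hB
  have hC0 : 0 < C := by linarith
  have hk : ∀ k : ℕ, 2 ^ k * B r₀ ≤ B (C ^ k * r₀) := by
    intro k
    induction k with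
    | zero => simp
    | succ k ih =>
      have h1 := h (C ^ k * r₀) (by positivity)
      rw [le_div_iff₀ (by positivity)] at h1
      have h0 : 0 < 2 ^ k * B r₀ := by positivity
      rw [pow_succ' C, mul_assoc C]
      calc 2 ^ (k + 1) * B r₀ = 2 ^ k * B r₀ * 2 := by ring
        _ ≤ B (C ^ k * r₀) * (2 * C) := mul_le_mul ih (by linarith) zero_le_two (h0.le.trans ih)
        _ ≤ _ := h1
  obtain ⟨k, hM⟩ := pow_unbounded_of_one_lt (M / B r₀) (one_lt_two (α := ℝ))
  rw [div_lt_iff₀ hpos] at hM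
  exact ⟨C ^ k * r₀, by positivity, hM.le.trans (hk k)⟩

theorem luxemburgNorm_nonneg (n : ℕ) (A : ℝ → ℝ) (f : EuclideanSpace ℝ (Fin n) → ℝ) :
    0 ≤ luxemburgNorm n A f :=
  Real.sInf_nonneg fun _ h => h.1.le

theorem luxemburgNorm_le {n : ℕ} {A : ℝ → ℝ} {f : EuclideanSpace ℝ (Fin n) → ℝ} {lam : ℝ}
    (hlam : 0 < lam) (h : ∫⁻ x, ENNReal.ofReal (A (|f x| / lam)) ≤ 1) :
    luxemburgNorm n A f ≤ lam :=
  csInf_le ⟨0, fun _ h => h.1.le⟩ ⟨hlam, h⟩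

/-- If `A` vanishes on `[0, ∞)`, so does the Luxemburg norm. -/
theorem luxemburgNorm_eq_zero {n : ℕ} {A : ℝ → ℝ} (hA : ∀ t, 0 ≤ t → A t ≤ 0)
    (f : EuclideanSpace ℝ (Fin n) → ℝ) : luxemburgNorm n A f = 0 := by
  refine le_antisymm (le_of_forall_gt_imp_ge_of_dense fun lam hlam => luxemburgNorm_le hlam ?_)
    (luxemburgNorm_nonneg n A f)
  have : ∀ x, ENNReal.ofReal (A (|f x| / lam)) = 0 := fun x =>
    ENNReal.ofReal_eq_zero.2 (hA _ (by positivity))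
  simp [this]

/-- If the Luxemburg constraint set contains arbitrarily small numbers, the function vanishes
almost everywhere. -/
theorem ae_eq_zero_of_luxemburgNorm_eq_zero {n : ℕ} {B : ℝ → ℝ} {α : ℝ} (hα : 0 < α)
    (hBm : MonotoneOn B (Ici 0)) (hBu : ∀ M : ℝ, ∃ r, 0 ≤ r ∧ M ≤ B r)
    {u : EuclideanSpace ℝ (Fin n) → ℝ} (hu : Measurable u)
    (hne : {lam : ℝ | 0 < lam ∧ ∫⁻ x, ENNReal.ofReal (B ((|u x| / lam) ^ α)) ≤ 1}.Nonempty)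
    (h0 : luxemburgNorm n (fun t => B (t ^ α)) u = 0) : ∀ᵐ x, u x = 0 := by
  have hpos : ∀ k : ℕ, volume {x | 1 / ((k : ℝ) + 1) ≤ |u x|} = 0 := by
    intro k
    set ε : ℝ := 1 / ((k : ℝ) + 1) with hε
    have hε0 : 0 < ε := by positivity
    by_contra hne0
    obtain ⟨N, hN⟩ := ENNReal.exists_nat_mul_gt hne0 (ENNReal.one_ne_top)
    obtain ⟨r, hr, hMr⟩ := hBu N
    have hlt : luxemburgNorm n (fun t => B (t ^ α)) u < ε / (r + 1) ^ (1 / α) := by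
      rw [h0]; positivity
    obtain ⟨lam, ⟨hlam0, hlam⟩, hlt⟩ := exists_lt_of_csInf_lt hne hlt
    have hr1 : r ≤ (ε / lam) ^ α := by
      have h1 : (r + 1) ^ (1 / α) ≤ ε / lam := by
        rw [lt_div_iff₀ (by positivity)] at hlt
        rw [le_div_iff₀ hlam0]
        linarith
      have h2 := Real.rpow_le_rpow (by positivity) h1 hα.le
      rw [← Real.rpow_mul (by positivity), one_div_mul_cancel hα.ne', Real.rpow_one] at h2
      linarith
    have hle : (N : ℝ≥0∞) * volume {x | ε ≤ |u x|} ≤ 1 := by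
      refine le_trans ?_ hlam
      have hms : MeasurableSet {x | ε ≤ |u x|} := measurableSet_le measurable_const hu.abs
      rw [← setLIntegral_const]
      refine (setLIntegral_mono' hms fun x hx => ?_).trans (setLIntegral_le_lintegral _ _)
      rw [← ENNReal.ofReal_natCast]
      refine ENNReal.ofReal_le_ofReal (hMr.trans (hBm hr (mem_Ici.2 (by positivity)) ?_))
      refine hr1.trans ?_
      have : ε ≤ |u x| := hx
      gcongr
    exact absurd hN (not_lt.2 hle)
  have hall := measure_iUnion_null hpos
  rw [ae_iff]
  refine measure_mono_null (fun x hx => ?_) hall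
  obtain ⟨k, hk⟩ := exists_nat_one_div_lt (abs_pos.2 hx)
  exact mem_iUnion.2 ⟨k, hk.le⟩

end Orlicz

/-- The Luxemburg norm of a function dominated by a power of the maximal function. -/
theorem exists_luxemburgNorm_le_of_le_maximalFn {n : ℕ} [Nontrivial (EuclideanSpace ℝ (Fin n))]
    {A : ℝ → ℝ} (hA : IsYoung A) {α σ : ℝ} (hα : 0 < α) (hσ : 0 < σ)
    (hA2 : Nabla2 fun t => A (t ^ σ)) :
    ∃ Q : ℝ, 0 < Q ∧ ∀ u : EuclideanSpace ℝ (Fin n) → ℝ, Measurable u →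
      {lam : ℝ | 0 < lam ∧ ∫⁻ y, ENNReal.ofReal (A ((|u y| / lam) ^ (α * σ))) ≤ 1}.Nonempty →
      ∀ (g : EuclideanSpace ℝ (Fin n) → ℝ) (D : ℝ), 0 ≤ D →
        (∀ x, ‖g x‖ₑ ≤ ENNReal.ofReal D * maximalFn volume (fun y => ‖u y‖ₑ ^ α) x ^ σ) →
        luxemburgNorm n A g ≤
          D * (Q * luxemburgNorm n (fun t => A (t ^ (α * σ))) u ^ (α * σ)) := by
  obtain ⟨C, hC, hdbl⟩ := hA2
  have hC0 : 0 < C := by linarith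
  have hC1 : 1 < ENNReal.ofReal C := ENNReal.one_lt_ofReal.2 hC
  set B : ℝ → ℝ := fun t => A (t ^ σ) with hB
  have hBm : MonotoneOn B (Ici 0) := fun s hs t ht hst =>
    hA.monotoneOn (Real.rpow_nonneg hs _) (Real.rpow_nonneg ht _)
      (Real.rpow_le_rpow hs hst hσ.le)
  have hB0 : B 0 = 0 := by simp only [hB]; rw [Real.zero_rpow hσ.ne', hA.map_zero]
  obtain ⟨K, hK0, hKt, HK⟩ := exists_lintegral_maximalFn_le
    (volume : Measure (EuclideanSpace ℝ (Fin n))) hC1 ENNReal.ofReal_ne_top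
  have hΦ0 : ennrealExtend B 0 = 0 := by
    have := ennrealExtend_ofReal hBm le_rfl
    rwa [hB0, ENNReal.ofReal_zero] at this
  specialize HK (ennrealExtend B) (ennrealExtend_mono B) hΦ0 (ennrealExtend_top_le B hC1)
    (mul_ennrealExtend_le hC0 hdbl)
  have hk : 0 < K.toReal := ENNReal.toReal_pos hK0 hKt
  have hQ : 0 < K.toReal ^ σ := by positivity
  refine ⟨K.toReal ^ σ, hQ, fun u hu hne g D hD hg => ?_⟩
  have hασ : 0 < α * σ := by positivity
  have key : ∀ D' : ℝ, D < D' → ∀ lam : ℝ, 0 < lam →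
      ∫⁻ y, ENNReal.ofReal (A ((|u y| / lam) ^ (α * σ))) ≤ 1 →
      luxemburgNorm n A g ≤ D' * (K.toReal ^ σ * lam ^ (α * σ)) := by
    intro D' hDD' lam hlam hle
    have hD' : 0 < D' := hD.trans_lt hDD'
    have hlα : 0 < lam ^ α := by positivity
    set b : ℝ := K.toReal * lam ^ α with hb
    have hb0 : 0 < b := by positivity
    set a : ℝ≥0∞ := ENNReal.ofReal b⁻¹ with ha
    have h_int : ∫⁻ x, ennrealExtend B
        (a * maximalFn volume (fun y => ‖u y‖ₑ ^ α) x) ≤ 1 := by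
      have h1 := HK (fun y => a * ‖u y‖ₑ ^ α) ((hu.enorm.pow_const _).const_mul _)
        (fun y => by finiteness)
      have hM : ∀ x, maximalFn volume (fun y => a * ‖u y‖ₑ ^ α) x =
          a * maximalFn volume (fun y => ‖u y‖ₑ ^ α) x := fun x =>
        maximalFn_const_mul (volume : Measure (EuclideanSpace ℝ (Fin n)))
          ENNReal.ofReal_ne_top x
      simp only [hM] at h1
      refine h1.trans (le_of_eq_of_le (lintegral_congr fun y => ?_) hle)
      have h2 : K * (a * ‖u y‖ₑ ^ α) = ENNReal.ofReal ((|u y| / lam) ^ α) := by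
        rw [Real.enorm_eq_ofReal_abs, ENNReal.ofReal_rpow_of_nonneg (abs_nonneg _) hα.le,
          ← ENNReal.ofReal_toReal hKt, ← ENNReal.ofReal_mul (by positivity),
          ← ENNReal.ofReal_mul hk.le, Real.div_rpow (abs_nonneg _) hlam.le, hb]
        congr 1
        field_simp
      rw [h2, ennrealExtend_ofReal hBm (by positivity), Real.rpow_mul (by positivity)]
    have hbσ : K.toReal ^ σ * lam ^ (α * σ) = b ^ σ := by
      rw [hb, Real.mul_rpow hk.le hlα.le, ← Real.rpow_mul hlam.le]
    rw [hbσ]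
    have hΛ : 0 < D' * b ^ σ := by positivity
    refine luxemburgNorm_le hΛ (le_trans (lintegral_mono fun x => ?_) h_int)
    set r : ℝ := (|g x| / (D' * b ^ σ)) ^ (1 / σ) with hr
    have hrσ : r ^ σ = |g x| / (D' * b ^ σ) := by
      rw [hr, ← Real.rpow_mul (by positivity), one_div_mul_cancel hσ.ne', Real.rpow_one]
    have hAB : A (|g x| / (D' * b ^ σ)) = B r := by rw [hB]; simp only; rw [hrσ]
    rw [hAB]
    refine ofReal_le_ennrealExtend B (by positivity) ?_
    rw [← ENNReal.rpow_le_rpow_iff hσ, ENNReal.ofReal_rpow_of_nonneg (by positivity) hσ.le, hrσ,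
      ENNReal.mul_rpow_of_nonneg _ _ hσ.le, ha,
      ENNReal.ofReal_rpow_of_nonneg (by positivity) hσ.le, div_eq_inv_mul,
      ENNReal.ofReal_mul (by positivity), ← Real.enorm_eq_ofReal_abs]
    calc ENNReal.ofReal (D' * b ^ σ)⁻¹ * ‖g x‖ₑ
        ≤ ENNReal.ofReal (D' * b ^ σ)⁻¹ * (ENNReal.ofReal D' *
            maximalFn volume (fun y => ‖u y‖ₑ ^ α) x ^ σ) := by
          gcongr
          refine (hg x).trans ?_
          gcongr
      _ = _ := by
          rw [← mul_assoc, ← ENNReal.ofReal_mul (by positivity), Real.inv_rpow hb0.le]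
          congr 2
          field_simp
  have key' : ∀ D' : ℝ, D < D' → luxemburgNorm n A g ≤
      D' * (K.toReal ^ σ * luxemburgNorm n (fun t => A (t ^ (α * σ))) u ^ (α * σ)) := by
    intro D' hDD'
    obtain ⟨v, -, hv, hvS⟩ := exists_seq_tendsto_sInf hne ⟨0, fun _ h => h.1.le⟩
    refine ge_of_tendsto' (((hv.rpow_const (Or.inr hασ.le)).const_mul _).const_mul D') fun k => ?_
    exact key D' hDD' (v k) (hvS k).1 (hvS k).2
  have hcont : Tendsto (fun D' : ℝ => D' * (K.toReal ^ σ *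
      luxemburgNorm n (fun t => A (t ^ (α * σ))) u ^ (α * σ))) (nhdsWithin D (Ioi D))
      (nhds (D * (K.toReal ^ σ *
        luxemburgNorm n (fun t => A (t ^ (α * σ))) u ^ (α * σ)))) :=
    ((continuous_id.mul continuous_const).tendsto D).mono_left nhdsWithin_le_nhds
  exact ge_of_tendsto hcont (eventually_nhdsWithin_of_forall fun D' hD' => key' D' hD')

/-- Sobolev inequality in Orlicz spaces: if `A_{1/α-1/β}` satisfies the
`∇₂`-condition, then under the hypotheses of the pointwise inequality and for
`∇f ∈ Ṁ^{α,αn/β}` with `∇f ∈ L^{A_{1-α/β}}`, one has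
`‖T_Ω f‖_{L^A} ≤ C ‖Ω‖_{L^ρ(𝕊^{n-1})} ‖∇f‖_{Ṁ^{α,αn/β}}^{α/β} ‖∇f‖_{L^{A_{1-α/β}}}^{1-α/β}`. -/
theorem orlicz_refined_sobolev (n : ℕ) (hn : 2 ≤ n) (ρ α β : ℝ) (hρ : 1 < ρ) (hρn : ρ < n)
    (hα₁ : ρ * n / (ρ * n + ρ - n) ≤ α) (hα : 1 < α) (hαβ : α < β) (hβ : β < n)
    (A : ℝ → ℝ) (hA : IsYoung A) (hA2 : Nabla2 (fun t => A (t ^ (1 / α - 1 / β)))) :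
    ∃ C : ℝ, 0 < C ∧
      ∀ (Ω : EuclideanSpace ℝ (Fin n) → ℝ), Measurable Ω →
        (∀ c : ℝ, 0 < c → ∀ y, Ω (c • y) = Ω y) →
        Integrable (fun z : sphere (0 : EuclideanSpace ℝ (Fin n)) 1 => Ω (z : EuclideanSpace ℝ (Fin n)))
          ((volume : Measure (EuclideanSpace ℝ (Fin n))).toSphere) →
        (∫ z : sphere (0 : EuclideanSpace ℝ (Fin n)) 1, Ω (z : EuclideanSpace ℝ (Fin n))
            ∂((volume : Measure (EuclideanSpace ℝ (Fin n))).toSphere)) = 0 →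
      ∀ (f : EuclideanSpace ℝ (Fin n) → ℝ), Differentiable ℝ f →
        morreyNorm n α (α * n / β) (fun y => ‖fderiv ℝ f y‖) < ∞ →
        (∃ lam : ℝ, 0 < lam ∧
          (∫⁻ y, ENNReal.ofReal (A ((‖fderiv ℝ f y‖ / lam) ^ (1 - α / β)))) ≤ 1) →
      ∀ (g : EuclideanSpace ℝ (Fin n) → ℝ),
        (∀ x, Tendsto (fun t : ℝ =>
            ∫ y in {y : EuclideanSpace ℝ (Fin n) | t < ‖y‖}, (Ω y / ‖y‖ ^ n) * f (x - y))
          (nhdsWithin 0 (Ioi 0)) (nhds (g x))) →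
        ENNReal.ofReal (luxemburgNorm n A g) ≤
          ENNReal.ofReal C *
            ((∫⁻ z : sphere (0 : EuclideanSpace ℝ (Fin n)) 1,
                ENNReal.ofReal (|Ω (z : EuclideanSpace ℝ (Fin n))| ^ ρ)
                ∂((volume : Measure (EuclideanSpace ℝ (Fin n))).toSphere)) ^ (1 / ρ)) *
            (morreyNorm n α (α * n / β) (fun y => ‖fderiv ℝ f y‖)) ^ (α / β) *
            ENNReal.ofReal
              ((luxemburgNorm n (fun t => A (t ^ (1 - α / β)))
                  (fun y => ‖fderiv ℝ f y‖)) ^ (1 - α / β)) := by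
  have hα0 : 0 < α := by linarith
  have hβ0 : 0 < β := by linarith
  have hn0 : (0 : ℝ) < n := by linarith
  have hρ0 : 0 < ρ := by linarith
  have : Nontrivial (EuclideanSpace ℝ (Fin n)) := by
    have : Nonempty (Fin n) := ⟨⟨0, by lia⟩⟩
    infer_instance
  set σ : ℝ := 1 / α - 1 / β with hσ
  have hσ0 : 0 < σ := by rw [hσ, sub_pos]; exact one_div_lt_one_div_of_lt hα0 hαβ
  have hασ : α * σ = 1 - α / β := by rw [hσ]; field_simp
  obtain ⟨Q, hQ, HQ⟩ := exists_luxemburgNorm_le_of_le_maximalFn (n := n) hA hα0 hσ0 hA2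
  obtain ⟨c, hc, H⟩ := exists_enorm_setIntegral_truncated_le
    (volume : Measure (EuclideanSpace ℝ (Fin n))) (ρ := ρ) (α := α) (β := β) hρ
    (by simpa using hρn) (by simpa using hα₁) hα0 hαβ
  simp only [finrank_euclideanSpace_fin] at H
  rw [hασ] at HQ
  refine ⟨c.toReal * Q + 1, by positivity, fun Ω hΩm hΩ h_int hzero f hf hN hne g hg => ?_⟩
  have hS : ∫⁻ z : sphere (0 : EuclideanSpace ℝ (Fin n)) 1, ENNReal.ofReal (|Ω z| ^ ρ)
      ∂(volume : Measure (EuclideanSpace ℝ (Fin n))).toSphere =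
      ∫⁻ z : sphere (0 : EuclideanSpace ℝ (Fin n)) 1, ‖Ω z‖ₑ ^ ρ
        ∂(volume : Measure (EuclideanSpace ℝ (Fin n))).toSphere := by
    refine lintegral_congr fun z => ?_
    rw [Real.enorm_eq_ofReal_abs, ENNReal.ofReal_rpow_of_nonneg (abs_nonneg _) hρ0.le]
  have hDm : Measurable fun y => ‖fderiv ℝ f y‖ := (measurable_fderiv ℝ f).norm
  have hmorrey : morreyNorm n α (α * n / β) (fun y => ‖fderiv ℝ f y‖) =
      ⨆ (x : EuclideanSpace ℝ (Fin n)) (r : ℝ) (_ : 0 < r),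
        (ENNReal.ofReal (r ^ (-((n : ℝ) - β))) *
          ∫⁻ y in ball x r, ‖fderiv ℝ f y‖ₑ ^ α) ^ (1 / α) := by
    have h1 : (n : ℝ) * (1 - α / (α * n / β)) = n - β := by field_simp
    have h2 : ∀ y, ENNReal.ofReal (|‖fderiv ℝ f y‖| ^ α) = ‖fderiv ℝ f y‖ₑ ^ α := fun y => by
      rw [abs_norm, ← ofReal_norm, ENNReal.ofReal_rpow_of_nonneg (norm_nonneg _) hα0.le]
    simp only [morreyNorm, h1, h2]
  rw [hS]
  set S : ℝ≥0∞ := (∫⁻ z : sphere (0 : EuclideanSpace ℝ (Fin n)) 1, ‖Ω z‖ₑ ^ ρ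
        ∂(volume : Measure (EuclideanSpace ℝ (Fin n))).toSphere) ^ (1 / ρ) with hSdef
  set N : ℝ≥0∞ := morreyNorm n α (α * n / β) (fun y => ‖fderiv ℝ f y‖) with hNdef
  set L : ℝ := luxemburgNorm n (fun t => A (t ^ (1 - α / β))) fun y => ‖fderiv ℝ f y‖ with hL
  have hL0 : 0 ≤ L := luxemburgNorm_nonneg _ _ _
  have hset : {lam : ℝ | 0 < lam ∧
      ∫⁻ y, ENNReal.ofReal (A ((|‖fderiv ℝ f y‖| / lam) ^ (1 - α / β))) ≤ 1}.Nonempty := by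
    simp only [abs_norm]
    exact hne
  have hpt : ∀ x, ‖g x‖ₑ ≤ c * S * N ^ (α / β) *
      maximalFn volume (fun y => ‖‖fderiv ℝ f y‖‖ₑ ^ α) x ^ σ := by
    intro x
    simp only [enorm_norm]
    refine le_of_tendsto (hg x).enorm (eventually_nhdsWithin_of_forall fun t ht => ?_)
    refine H Ω ⟨hΩm, hΩ, h_int, hzero⟩ f hf N (fun x r hr => ?_) x t ht
    rw [hmorrey]
    exact le_iSup_of_le x (le_iSup_of_le r (le_iSup_of_le hr le_rfl))
  by_cases hD : c * S * N ^ (α / β) = ∞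
  swap
  · have h1 := HQ _ hDm hset g (c * S * N ^ (α / β)).toReal ENNReal.toReal_nonneg
      (by rw [ENNReal.ofReal_toReal hD]; exact hpt)
    calc ENNReal.ofReal (luxemburgNorm n A g)
        ≤ ENNReal.ofReal ((c * S * N ^ (α / β)).toReal * (Q * L ^ (1 - α / β))) :=
          ENNReal.ofReal_le_ofReal h1
      _ = ENNReal.ofReal (c.toReal * Q) * S * N ^ (α / β) * ENNReal.ofReal (L ^ (1 - α / β)) := by
          rw [ENNReal.ofReal_mul ENNReal.toReal_nonneg, ENNReal.ofReal_toReal hD,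
            ENNReal.ofReal_mul hQ.le, ENNReal.ofReal_mul ENNReal.toReal_nonneg,
            ENNReal.ofReal_toReal hc]
          ring
      _ ≤ _ := by
          gcongr
          linarith
  have hNβ : N ^ (α / β) ≠ ∞ := ENNReal.rpow_ne_top_of_nonneg (by positivity) hN.ne
  have hST : S = ∞ := by
    by_contra hST
    exact ENNReal.mul_ne_top (ENNReal.mul_ne_top hc hST) hNβ hD
  have hN0 : N ^ (α / β) ≠ 0 := by
    intro h0
    rw [h0, mul_zero] at hD
    exact ENNReal.zero_ne_top hD
  rcases hL0.lt_or_eq with hLpos | hLz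
  · have hC : ENNReal.ofReal (c.toReal * Q + 1) ≠ 0 := by
      rw [ne_eq, ENNReal.ofReal_eq_zero, not_le]; positivity
    have hLp : ENNReal.ofReal (L ^ (1 - α / β)) ≠ 0 := by
      rw [ne_eq, ENNReal.ofReal_eq_zero, not_le]; positivity
    rw [hST, ENNReal.mul_top hC, ENNReal.top_mul hN0, ENNReal.top_mul hLp]
    exact le_top
  suffices h : luxemburgNorm n A g = 0 by simp [h]
  refine luxemburgNorm_eq_zero (fun T hT => ?_) g
  by_contra! hpos
  set B : ℝ → ℝ := fun t => A (t ^ σ) with hB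
  have hBm : MonotoneOn B (Ici 0) := fun s hs t ht hst =>
    hA.monotoneOn (Real.rpow_nonneg hs _) (Real.rpow_nonneg ht _)
      (Real.rpow_le_rpow hs hst hσ0.le)
  have hBT : 0 < B (T ^ (1 / σ)) := by
    simp only [hB]
    rwa [← Real.rpow_mul hT, one_div_mul_cancel hσ0.ne', Real.rpow_one]
  have hBα : ∀ t : ℝ, 0 ≤ t → B (t ^ α) = A (t ^ (1 - α / β)) := fun t ht => by
    simp only [hB]
    rw [← Real.rpow_mul ht, hασ]
  have hae : ∀ᵐ y, ‖fderiv ℝ f y‖ = 0 := by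
    have hcongr : ∀ lam : ℝ, 0 < lam →
        ∫⁻ y, ENNReal.ofReal (B ((|‖fderiv ℝ f y‖| / lam) ^ α)) =
          ∫⁻ y, ENNReal.ofReal (A ((|‖fderiv ℝ f y‖| / lam) ^ (1 - α / β))) := fun lam hlam =>
      lintegral_congr fun y => by rw [hBα _ (by positivity)]
    refine ae_eq_zero_of_luxemburgNorm_eq_zero hα0 hBm
      (hA2.exists_le (by positivity) hBT) hDm ?_ ?_
    · obtain ⟨lam, hlam, hle⟩ := hset
      exact ⟨lam, hlam, by rwa [hcongr lam hlam]⟩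
    · rw [hLz, hL, luxemburgNorm, luxemburgNorm]
      congr 1
      ext lam
      exact and_congr_right fun hlam => by rw [hcongr lam hlam]
  refine hN0 ?_
  rw [hmorrey]
  have h0 : ∀ (x : EuclideanSpace ℝ (Fin n)) (r : ℝ),
      ∫⁻ y in ball x r, ‖fderiv ℝ f y‖ₑ ^ α = 0 := by
    intro x r
    refine (lintegral_congr_ae (ae_restrict_of_ae ?_)).trans lintegral_zero
    filter_upwards [hae] with y hy
    rw [← ofReal_norm, hy, ENNReal.ofReal_zero, ENNReal.zero_rpow_of_pos hα0]
  have hαβ' : 0 < α / β := by positivity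
  simp [h0, hα0, hαβ']
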